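/- arXiv:2203.05746 — 2 statements merged into one kernel-verified Lean document; each statement's English description precedes it below -/
import Mathlib

section
/- Let G be the fundamental group of a finite graph of groups with vertex groups G_v and edge groups G_e, all finitely generated. Then asdim G ≤ max over vertices v and edges e of {asdim G_v, asdim G_e + 1}. -/
def wordBall {G : Type*} [Group G] (S : Set G) (R : ℕ) (g : G) : Set G :=
  {h | ∃ w : List G, w.length ≤ R ∧ (∀ x ∈ w, x ∈ S ∨ x⁻¹ ∈ S) ∧ h = g * w.prod}

def AsdimLE (G : Type*) [Group G] (n : ℕ) : Prop :=
  ∀ S : Finset G, Subgroup.closure (S : Set G) = ⊤ →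
    ∀ R : ℕ, ∃ 𝒰 : Set (Set G), ⋃₀ 𝒰 = Set.univ ∧
      (∃ B : ℕ, ∀ U ∈ 𝒰, ∀ x ∈ U, ∀ y ∈ U, y ∈ wordBall (S : Set G) B x) ∧
      ∀ g : G, {U ∈ 𝒰 | (wordBall (S : Set G) R g ∩ U).Nonempty}.Finite ∧
        Nat.card {U ∈ 𝒰 | (wordBall (S : Set G) R g ∩ U).Nonempty} ≤ n + 1

noncomputable def asdim (G : Type*) [Group G] : ℕ∞ :=
  sInf ((↑) '' {n : ℕ | AsdimLE G n})

namespace AsdimGG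

section WB
variable {G : Type} [Group G] {S : Set G}

lemma wb_iff {R : ℕ} {g h : G} : h ∈ wordBall S R g ↔ g⁻¹ * h ∈ wordBall S R 1 := by
  constructor
  · rintro ⟨w, h1, h2, rfl⟩
    exact ⟨w, h1, h2, by group⟩
  · rintro ⟨w, h1, h2, h3⟩
    refine ⟨w, h1, h2, ?_⟩
    rw [one_mul] at h3
    rw [← h3]; group

lemma wb_self (R : ℕ) (g : G) : g ∈ wordBall S R g := ⟨[], by simp, by simp, by simp⟩

lemma wb_mono {R R' : ℕ} (h : R ≤ R') {g k : G} (hk : k ∈ wordBall S R g) :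
    k ∈ wordBall S R' g := by
  obtain ⟨w, h1, h2, h3⟩ := hk
  exact ⟨w, h1.trans h, h2, h3⟩

lemma wb_trans {R R' : ℕ} {g h k : G} (h1 : h ∈ wordBall S R g) (h2 : k ∈ wordBall S R' h) :
    k ∈ wordBall S (R + R') g := by
  obtain ⟨w, a1, a2, rfl⟩ := h1
  obtain ⟨w', b1, b2, rfl⟩ := h2
  refine ⟨w ++ w', by simp; omega, ?_, by simp [mul_assoc]⟩
  intro x hx
  rcases List.mem_append.1 hx with hx | hx
  · exact a2 x hx
  · exact b2 x hx

lemma wb_symm {R : ℕ} {g h : G} (h1 : h ∈ wordBall S R g) : g ∈ wordBall S R h := by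
  obtain ⟨w, a1, a2, rfl⟩ := h1
  refine ⟨(w.map (fun x => x⁻¹)).reverse, by simpa using a1, ?_, ?_⟩
  · intro x hx
    simp only [List.mem_reverse, List.mem_map] at hx
    obtain ⟨y, hy, rfl⟩ := hx
    rw [inv_inv]
    exact (a2 y hy).symm
  · rw [← List.prod_inv_reverse]; group

lemma wb_finite (hS : S.Finite) (R : ℕ) (g : G) : (wordBall S R g).Finite := by
  have hS' : (S ∪ S⁻¹).Finite := hS.union hS.inv
  have h2 : ({w : List G | w.length ≤ R ∧ ∀ x ∈ w, x ∈ S ∪ S⁻¹}).Finite := by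
    have := hS'.to_subtype
    have := List.finite_length_le (S ∪ S⁻¹ : Set G) R
    refine (this.image (fun l => l.map Subtype.val)).subset ?_
    rintro w ⟨h1, h2⟩
    refine ⟨w.attach.map (fun x => ⟨x.1, h2 x.1 x.2⟩), by simpa using h1, by simp⟩
  refine (h2.image (fun w => g * w.prod)).subset ?_
  rintro h ⟨w, a1, a2, rfl⟩
  exact ⟨w, ⟨a1, fun x hx => by simpa using a2 x hx⟩, rfl⟩

lemma wb_exh (hS : Subgroup.closure S = ⊤) (g : G) : ∃ R, g ∈ wordBall S R 1 := by
  have hg : g ∈ Subgroup.closure S := by rw [hS]; trivial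
  induction hg using Subgroup.closure_induction with
  | mem x hx => exact ⟨1, [x], by simp, by simp [hx], by simp⟩
  | one => exact ⟨0, wb_self _ _⟩
  | mul x y _ _ hx hy =>
    obtain ⟨R, hR⟩ := hx
    obtain ⟨R', hR'⟩ := hy
    refine ⟨R + R', wb_trans hR ?_⟩
    rw [wb_iff]; simpa using hR'
  | inv x _ hx =>
    obtain ⟨R, hR⟩ := hx
    refine ⟨R, ?_⟩
    have := wb_symm hR
    rw [wb_iff] at this; simpa using this

lemma wb_exh_fin (hS : Subgroup.closure S = ⊤) {F : Set G} (hF : F.Finite) :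
    ∃ R, F ⊆ wordBall S R 1 := by
  choose r hr using wb_exh hS
  obtain ⟨M, hM⟩ := (hF.image r).bddAbove
  exact ⟨M, fun x hx => wb_mono (hM ⟨x, hx, rfl⟩) (hr x)⟩
end WB

def ColG (K : Type) [Group K] (k : ℕ) : Prop :=
  ∀ F : Set K, F.Finite → ∃ B : Set K, B.Finite ∧ ∃ (c : K → ℕ) (l : K → Set (Set K)),
    (∀ a, c a < k) ∧ (∀ a b, a⁻¹ * b ∈ F → c a = c b → l a = l b) ∧
    (∀ a b, c a = c b → l a = l b → a⁻¹ * b ∈ B)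

lemma ColG.mono {K : Type} [Group K] {k k' : ℕ} (h : ColG K k) (hk : k ≤ k') : ColG K k' := by
  intro F hF
  obtain ⟨B, hB, c, l, h1, h2⟩ := h F hF
  exact ⟨B, hB, c, l, fun a => (h1 a).trans_le hk, h2⟩

lemma gap_exists (m : ℕ) (a : ℕ → ℕ) (h0 : 1 ≤ a 0) (hm : a (m + 1) ≤ m + 1)
    (hmono : Monotone a) : ∃ i ≤ m, a i = a (i + 1) := by
  by_contra! hcon
  have : ∀ i ≤ m + 1, i + 1 ≤ a i := by
    intro i
    induction i with
    | zero => intro _; simpa using h0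
    | succ i ih =>
      intro hi
      have h1 := ih (by omega)
      have h2 := hcon i (by omega)
      have h3 := hmono (Nat.le_succ i)
      simp only [Nat.succ_eq_add_one] at h3
      omega
  have := this (m + 1) le_rfl
  omega

lemma colG_of_asdimLE {K : Type} [Group K] [hfg : Group.FG K] {m : ℕ} (h : AsdimLE K m) :
    ColG K (m + 1) := by
  classical
  intro F hF
  obtain ⟨S, hS⟩ := Group.fg_def.1 hfg
  obtain ⟨r, hr⟩ := wb_exh_fin hS hF
  obtain ⟨U, hcov, ⟨B0, hB0⟩, hmult⟩ := h S hS ((m + 1) * r)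
  let H : ℕ → K → Set (Set K) := fun i x => {V ∈ U | (wordBall (S : Set K) (i * r) x ∩ V).Nonempty}
  have Hmono : ∀ x i j, i ≤ j → H i x ⊆ H j x := by
    rintro x i j hij V ⟨hV, z, hz, hzV⟩
    exact ⟨hV, z, wb_mono (Nat.mul_le_mul_right r hij) hz, hzV⟩
  have Hfin : ∀ x i, i ≤ m + 1 → (H i x).Finite := fun x i hi =>
    (hmult x).1.subset (Hmono x i _ hi)
  have Hcard : ∀ x i, i ≤ m + 1 → (H i x).ncard ≤ m + 1 := fun x i hi =>
    (Set.ncard_le_ncard (Hmono x i _ hi) (hmult x).1).trans (by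
      have := (hmult x).2
      rwa [Nat.card_coe_set_eq] at this)
  have Hne : ∀ x i, (H i x).Nonempty := by
    intro x i
    have hx : x ∈ ⋃₀ U := by rw [hcov]; trivial
    obtain ⟨V, hV, hxV⟩ := hx
    exact ⟨V, hV, x, wb_self _ _, hxV⟩
  have hgap : ∀ x, ∃ i ≤ m, H i x = H (i + 1) x := by
    intro x
    obtain ⟨i, hi, he⟩ := gap_exists m (fun i => (H (min i (m + 1)) x).ncard)
      ((Set.ncard_pos (Hfin x _ (min_le_right _ _))).2 (Hne x _))
      (Hcard x _ (min_le_right _ _))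
      (fun i j hij => Set.ncard_le_ncard (Hmono x _ _ (min_le_min_right _ hij))
        (Hfin x _ (min_le_right _ _)))
    refine ⟨i, hi, ?_⟩
    simp only [min_eq_left (show i ≤ m + 1 by omega),
      min_eq_left (show i + 1 ≤ m + 1 by omega)] at he
    exact Set.eq_of_subset_of_ncard_le (Hmono x _ _ (by omega)) he.ge (Hfin x _ (by omega))
  choose i hi hiH using hgap
  refine ⟨_, wb_finite S.finite_toSet ((m + 1) * r + (B0 + (m + 1) * r)) 1,
    fun x => (H (i x) x).ncard - 1, fun x => H (i x) x, ?_, ?_, ?_⟩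
  · intro x
    have := Hcard x (i x) (by have := hi x; omega)
    simp only
    omega
  · have key : ∀ a b, b ∈ wordBall (S : Set K) r a → i a ≤ i b →
        (H (i a) a).ncard - 1 = (H (i b) b).ncard - 1 → H (i a) a = H (i b) b := by
      intro a b hab hle hc
      have h1 : H (i a) a ⊆ H (i b) b := by
        rw [hiH b]
        rintro V ⟨hV, z, hz, hzV⟩
        refine ⟨hV, z, ?_, hzV⟩
        refine wb_mono ?_ (wb_trans (wb_symm hab) hz)
        nlinarith
      have p1 := (Set.ncard_pos (Hfin a (i a) (by have := hi a; omega))).2 (Hne a _)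
      have p2 := (Set.ncard_pos (Hfin b (i b) (by have := hi b; omega))).2 (Hne b _)
      exact Set.eq_of_subset_of_ncard_le h1 (by omega) (Hfin b _ (by have := hi b; omega))
    intro a b hab hc
    have hab' : b ∈ wordBall (S : Set K) r a := wb_iff.2 (hr hab)
    rcases le_total (i a) (i b) with hle | hle
    · exact key a b hab' hle hc
    · exact (key b a (wb_symm hab') hle hc.symm).symm
  · intro a b _ hl
    simp only at hl
    obtain ⟨V, hV⟩ := Hne a (i a)
    have hV' := hV
    rw [hl] at hV'
    obtain ⟨hVU, z, hz, hzV⟩ := Hmono a _ (m + 1) (by have := hi a; omega) hV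
    obtain ⟨_, z', hz', hzV'⟩ := Hmono b _ (m + 1) (by have := hi b; omega) hV'
    rw [← wb_iff]
    exact wb_trans hz (wb_trans (hB0 V hVU z hzV z' hzV') (wb_symm hz'))

end AsdimGG
namespace AsdimGG

section Col
variable {X : Type}

def Col (d : X → X → ℕ) (k : ℕ) (Y : Set X) (R B : ℕ) : Prop :=
  ∃ (c : X → ℕ) (l : X → X), (∀ x ∈ Y, c x < k) ∧
    (∀ x ∈ Y, ∀ y ∈ Y, d x y ≤ R → c x = c y → l x = l y) ∧
    (∀ x ∈ Y, ∀ y ∈ Y, c x = c y → l x = l y → d x y ≤ B)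

lemma Col.of_label {Λ : Type} {d : X → X → ℕ} {k : ℕ} {Y : Set X} {R B : ℕ}
    (c : X → ℕ) (l : X → Λ) (h1 : ∀ x ∈ Y, c x < k)
    (h2 : ∀ x ∈ Y, ∀ y ∈ Y, d x y ≤ R → c x = c y → l x = l y)
    (h3 : ∀ x ∈ Y, ∀ y ∈ Y, c x = c y → l x = l y → d x y ≤ B) : Col d k Y R B := by
  classical
  by_cases hX : Nonempty X
  swap
  · exact ⟨c, fun x => x, h1, fun x => (hX ⟨x⟩).elim, fun x => (hX ⟨x⟩).elim⟩
  let rep : ℕ × Λ → X := fun q => Classical.epsilon (fun y => y ∈ Y ∧ c y = q.1 ∧ l y = q.2)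
  have hrep : ∀ x ∈ Y, rep (c x, l x) ∈ Y ∧ c (rep (c x, l x)) = c x ∧ l (rep (c x, l x)) = l x :=
    fun x hx => Classical.epsilon_spec (p := fun y => y ∈ Y ∧ c y = c x ∧ l y = l x)
      ⟨x, hx, rfl, rfl⟩
  refine ⟨c, fun x => rep (c x, l x), h1, ?_, ?_⟩
  · intro x hx y hy hd hc
    simp only [hc, h2 x hx y hy hd hc]
  · intro x hx y hy hc hl
    refine h3 x hx y hy hc ?_
    rw [← (hrep x hx).2.2, ← (hrep y hy).2.2]
    simp only at hl
    rw [hl]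

lemma Col.subset {d : X → X → ℕ} {k : ℕ} {Y Y' : Set X} {R B : ℕ} (h : Col d k Y R B)
    (hs : Y' ⊆ Y) : Col d k Y' R B := by
  obtain ⟨c, l, h1, h2, h3⟩ := h
  exact ⟨c, l, fun x hx => h1 x (hs hx), fun x hx y hy => h2 x (hs hx) y (hs hy),
    fun x hx y hy => h3 x (hs hx) y (hs hy)⟩

structure PM (d : X → X → ℕ) : Prop where
  self : ∀ x, d x x = 0
  symm : ∀ x y, d x y = d y x
  tri : ∀ x y z, d x z ≤ d x y + d y z

lemma Col.nbhd {d : X → X → ℕ} (hd : PM d) {k : ℕ} {Y : Set X} {R B : ℕ} (r : ℕ)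
    (h : Col d k Y (R + 2 * r) B) : Col d k {x | ∃ y ∈ Y, d x y ≤ r} R (B + 2 * r) := by
  classical
  obtain ⟨c, l, h1, h2, h3⟩ := h
  have hp : ∀ x : X, ∃ y, (∃ y ∈ Y, d x y ≤ r) → y ∈ Y ∧ d x y ≤ r := by
    intro x
    by_cases h : ∃ y ∈ Y, d x y ≤ r
    · obtain ⟨y, hy⟩ := h
      exact ⟨y, fun _ => hy⟩
    · exact ⟨x, fun h' => (h h').elim⟩
  choose p hp using hp
  refine ⟨fun x => c (p x), fun x => l (p x), ?_, ?_, ?_⟩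
  · intro x hx
    exact h1 _ (hp x hx).1
  · intro x hx y hy hxy hc
    refine h2 _ (hp x hx).1 _ (hp y hy).1 ?_ hc
    have a1 := (hp x hx).2
    have a2 := (hp y hy).2
    have a3 := hd.tri (p x) x (p y)
    have a4 := hd.tri x y (p y)
    have a5 := hd.symm x (p x)
    omega
  · intro x hx y hy hc hl
    have := h3 _ (hp x hx).1 _ (hp y hy).1 hc hl
    have a1 := (hp x hx).2
    have a2 := (hp y hy).2
    have a3 := hd.tri x (p x) y
    have a4 := hd.tri (p x) (p y) y
    have a5 := hd.symm y (p y)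
    omega

lemma Col.union {d : X → X → ℕ} (hd : PM d) {k : ℕ} {A A' Y : Set X} {R B B' : ℕ}
    (h : Col d k A R B) (h' : Col d k A' (B + 2 * R) B') (hY : Y ⊆ A ∪ A') :
    Col d k Y R (B' + 2 * (B + R)) := by
  classical
  obtain ⟨c, l, h1, h2, h3⟩ := h
  obtain ⟨c', l', h1', h2', h3'⟩ := h'
  let Q : X → X → Prop := fun x z => z ∈ A' ∧ c' z = c x ∧ ∃ a ∈ A, c a = c x ∧ l a = l x ∧ d a z ≤ R
  have hp : ∀ x : X, ∃ z, (∃ z, Q x z) → Q x z := by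
    intro x
    by_cases h : ∃ y, Q x y
    · obtain ⟨y, hy⟩ := h
      exact ⟨y, fun _ => hy⟩
    · exact ⟨x, fun h' => (h h').elim⟩
  choose p hp using hp
  have hQQ : ∀ x y z w, c x = c y → l x = l y → Q x z → Q y w → l' z = l' w := by
    rintro x y z w hc hl ⟨z1, z2, a, ha, z3, z4, z5⟩ ⟨w1, w2, b, hb, w3, w4, w5⟩
    refine h2' z z1 w w1 ?_ (by omega)
    have := h3 a ha b hb (by omega) (by rw [z4, w4, hl])
    have t1 := hd.tri z a w
    have t2 := hd.tri a b w
    have t3 := hd.symm a z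
    omega
  have hQt : ∀ x y z, c x = c y → l x = l y → Q x z → Q y z := by
    rintro x y z hc hl ⟨z1, z2, a, ha, z3, z4, z5⟩
    exact ⟨z1, by omega, a, ha, by omega, by rw [z4, hl], z5⟩
  have hQd : ∀ x z, x ∈ A → Q x z → d x z ≤ B + R := by
    rintro x z hx ⟨z1, z2, a, ha, z3, z4, z5⟩
    have := h3 x hx a ha z3.symm z4.symm
    have := hd.tri x a z
    omega
  let lab : X → X ⊕ X := fun x =>
    if x ∈ A' then Sum.inl (l' x) else if ∃ z, Q x z then Sum.inl (l' (p x)) else Sum.inr (l x)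
  let col : X → ℕ := fun x => if x ∈ A' then c' x else c x
  -- each labelled point is close to a point of A'
  have hinl : ∀ x ∈ Y, ∀ w, lab x = Sum.inl w → ∃ z ∈ A', c' z = col x ∧ l' z = w ∧ d x z ≤ B + R := by
    intro x hx w hw
    by_cases hxA : x ∈ A'
    · simp only [lab, hxA, if_true, Sum.inl.injEq] at hw
      exact ⟨x, hxA, by simp [col, hxA], hw, by rw [hd.self]; omega⟩
    · by_cases hq : ∃ z, Q x z
      · simp only [lab, hxA, if_false, hq, if_true, Sum.inl.injEq] at hw
        have := hp x hq
        exact ⟨p x, this.1, by simp [col, hxA, this.2.1], hw,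
          hQd x _ ((hY hx).resolve_right hxA) this⟩
      · simp [lab, hxA, hq] at hw
  refine Col.of_label col lab ?_ ?_ ?_
  · intro x hx
    by_cases hxA : x ∈ A'
    · simpa [col, hxA] using h1' x hxA
    · simpa [col, hxA] using h1 x ((hY hx).resolve_right hxA)
  · have key : ∀ x ∈ Y, ∀ y ∈ Y, d x y ≤ R → col x = col y → x ∈ A' → lab x = lab y := by
      intro x hx y hy hxy hc hxA
      by_cases hyA : y ∈ A'
      · simp only [col, hxA, hyA, if_true] at hc
        simp only [lab, hxA, hyA, if_true]
        rw [h2' x hxA y hyA (by omega) hc]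
      · simp only [col, hxA, hyA, if_true, if_false] at hc
        have hq : Q y x := ⟨hxA, hc, y, (hY hy).resolve_right hyA, rfl, rfl, by rw [hd.symm]; exact hxy⟩
        have hq' : ∃ z, Q y z := ⟨x, hq⟩
        simp only [lab, hxA, hyA, if_true, if_false, hq']
        rw [hQQ y y x (p y) rfl rfl hq (hp y hq')]
    intro x hx y hy hxy hc
    by_cases hxA : x ∈ A'
    · exact key x hx y hy hxy hc hxA
    by_cases hyA : y ∈ A'
    · exact (key y hy x hx (by rw [hd.symm]; exact hxy) hc.symm hyA).symm
    simp only [col, hxA, hyA, if_false] at hc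
    have hl := h2 x ((hY hx).resolve_right hxA) y ((hY hy).resolve_right hyA) hxy hc
    by_cases hq : ∃ z, Q x z
    · have hq' : ∃ z, Q y z := by
        obtain ⟨z, hz⟩ := hq
        exact ⟨z, hQt x y z hc hl hz⟩
      simp only [lab, hxA, hyA, if_false, hq, hq', if_true]
      rw [hQQ x y _ _ hc hl (hp x hq) (hp y hq')]
    · have hq' : ¬ ∃ z, Q y z := by
        rintro ⟨z, hz⟩
        exact hq ⟨z, hQt y x z hc.symm hl.symm hz⟩
      simp only [lab, hxA, hyA, if_false, hq, hq', hl]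
  · intro x hx y hy hc hl
    rcases hlx : lab x with w | w
    · obtain ⟨z, z1, z2, z3, z4⟩ := hinl x hx w hlx
      obtain ⟨z', z1', z2', z3', z4'⟩ := hinl y hy w (hl ▸ hlx)
      have t0 := h3' z z1 z' z1' (by omega) (by rw [z3, z3'])
      have t1 := hd.tri x z y
      have t2 := hd.tri z z' y
      have t3 := hd.symm y z'
      omega
    · have aux : ∀ x, lab x = Sum.inr w → x ∉ A' ∧ l x = w := by
        intro x hx
        by_cases hxA : x ∈ A'
        · simp [lab, hxA] at hx
        · by_cases hq : ∃ z, Q x z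
          · simp [lab, hxA, hq] at hx
          · simp only [lab, hxA, if_false, hq, Sum.inr.injEq] at hx
            exact ⟨hxA, hx⟩
      obtain ⟨a1, a2⟩ := aux x hlx
      obtain ⟨b1, b2⟩ := aux y (hl ▸ hlx)
      simp only [col, a1, b1, if_false] at hc
      have := h3 x ((hY hx).resolve_right a1) y ((hY hy).resolve_right b1) hc (by rw [a2, b2])
      omega

/-- the partition theorem -/
lemma partition_thm {V : Type} {d : X → X → ℕ} (hd : PM d) (n R D B : ℕ) (piece : X → V)
    (hW : Col d n {x | ∃ y, piece y ≠ piece x ∧ d x y ≤ (n + 1) * (2 * R + 1)} (2 * R) D)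
    (hP : ∀ p, Col d (n + 1) {x | piece x = p} (2 * R + 2 * D) B) :
    ∃ (J : Type) (Φ : X → J), (∀ x y, Φ x = Φ y → d x y ≤ B + 2 * D) ∧
      ∀ x, ∃ code : X → ℕ, (∀ y, d x y ≤ R → code y < n + 1) ∧
        ∀ y₁ y₂, d x y₁ ≤ R → d x y₂ ≤ R → code y₁ = code y₂ → Φ y₁ = Φ y₂ := by
  classical
  by_cases hX : Nonempty X
  swap
  · exact ⟨X, id, fun x => (hX ⟨x⟩).elim, fun x => (hX ⟨x⟩).elim⟩
  let T : ℕ → X → Prop := fun m x => ∃ y, piece y ≠ piece x ∧ d x y ≤ m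
  have Tmono : ∀ m m' x, m ≤ m' → T m x → T m' x := by
    rintro m m' x h ⟨y, h1, h2⟩
    exact ⟨y, h1, h2.trans h⟩
  set L := (n + 1) * (2 * R + 1) with hL
  set ρ := 2 * R + 1 with hρ
  obtain ⟨c, l, h1, h2, h3⟩ := hW
  choose cp mp g1 g2 g3 using hP
  let rep : ℕ → X → V → X := fun j w p =>
    Classical.epsilon (fun y => T L y ∧ c y = j ∧ l y = w ∧ piece y = p)
  have hrep : ∀ x, T L x → T L (rep (c x) (l x) (piece x)) ∧ c (rep (c x) (l x) (piece x)) = c x ∧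
      l (rep (c x) (l x) (piece x)) = l x ∧ piece (rep (c x) (l x) (piece x)) = piece x :=
    fun x hx => Classical.epsilon_spec
      (p := fun y => T L y ∧ c y = c x ∧ l y = l x ∧ piece y = piece x) ⟨x, hx, rfl, rfl, rfl⟩
  let q : X → X := fun x => if T L x then rep (c x) (l x) (piece x) else x
  have hqp : ∀ x, piece (q x) = piece x := by
    intro x
    by_cases hx : T L x
    · simpa [q, hx] using (hrep x hx).2.2.2
    · simp [q, hx]
  have hqd : ∀ x, d x (q x) ≤ D := by
    intro x
    by_cases hx : T L x
    · obtain ⟨r1, r2, r3, r4⟩ := hrep x hx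
      simp only [q, hx, if_true]
      exact h3 x hx _ r1 r2.symm r3.symm
    · simp [q, hx, hd.self]
  let Φ : X → (ℕ × X) ⊕ (V × ℕ × X) := fun x =>
    if T L x ∧ T ((c x + 1) * ρ) x then Sum.inl (c x, l x)
    else Sum.inr (piece x, cp (piece x) (q x), mp (piece x) (q x))
  have Φl : ∀ x, (T L x ∧ T ((c x + 1) * ρ) x) → Φ x = Sum.inl (c x, l x) := by
    intro x hx
    simp only [Φ]; rw [if_pos hx]
  have Φr : ∀ x, ¬ (T L x ∧ T ((c x + 1) * ρ) x) →
      Φ x = Sum.inr (piece x, cp (piece x) (q x), mp (piece x) (q x)) := by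
    intro x hx
    simp only [Φ]; rw [if_neg hx]
  refine ⟨_, Φ, ?_, ?_⟩
  · intro x y hxy
    by_cases hx : T L x ∧ T ((c x + 1) * ρ) x <;> by_cases hy : T L y ∧ T ((c y + 1) * ρ) y
    · rw [Φl x hx, Φl y hy] at hxy
      simp only [Sum.inl.injEq, Prod.mk.injEq] at hxy
      have := h3 x hx.1 y hy.1 hxy.1 hxy.2
      omega
    · rw [Φl x hx, Φr y hy] at hxy; simp at hxy
    · rw [Φr x hx, Φl y hy] at hxy; simp at hxy
    · rw [Φr x hx, Φr y hy] at hxy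
      simp only [Sum.inr.injEq, Prod.mk.injEq] at hxy
      obtain ⟨e1, e2, e3⟩ := hxy
      rw [e1] at e2 e3
      have := g3 (piece y) (q x) ((hqp x).trans e1) (q y) (hqp y) e2 e3
      have t1 := hd.tri x (q x) y
      have t2 := hd.tri (q x) (q y) y
      have t3 := hd.symm y (q y)
      have t4 := hqd x
      have t5 := hqd y
      omega
  · intro x
    have dball : ∀ y₁ y₂, d x y₁ ≤ R → d x y₂ ≤ R → d y₁ y₂ ≤ 2 * R := by
      intro y₁ y₂ a1 a2
      have := hd.tri y₁ x y₂
      have := hd.symm y₁ x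
      omega
    by_cases hA : T R x
    · -- everything in the ball is of the first type
      have hall : ∀ y, d x y ≤ R → T (2 * R) y := by
        intro y hy
        by_cases hpy : piece y = piece x
        · obtain ⟨w, w1, w2⟩ := hA
          refine ⟨w, by rwa [hpy], ?_⟩
          have := hd.tri y x w
          have := hd.symm y x
          omega
        · exact ⟨x, fun h => hpy h.symm, by rw [hd.symm]; omega⟩
      have hall' : ∀ y, d x y ≤ R → T L y ∧ T ((c y + 1) * ρ) y := by
        intro y hy
        refine ⟨Tmono _ _ y ?_ (hall y hy), Tmono _ _ y ?_ (hall y hy)⟩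
        · rw [hL]; nlinarith
        · rw [hρ]; nlinarith
      refine ⟨c, fun y hy => Nat.lt_succ_of_lt (h1 y (hall' y hy).1), ?_⟩
      intro y₁ y₂ a1 a2 hc
      rw [Φl _ (hall' _ a1), Φl _ (hall' _ a2), hc,
        h2 y₁ (hall' _ a1).1 y₂ (hall' _ a2).1 (dball _ _ a1 a2) hc]
    · have hpc : ∀ y, d x y ≤ R → piece y = piece x := by
        intro y hy
        by_contra hne
        exact hA ⟨y, hne, hy⟩
      have Ttr : ∀ m y₁ y₂, d x y₁ ≤ R → d x y₂ ≤ R → T m y₁ → T (m + 2 * R) y₂ := by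
        rintro m y₁ y₂ a1 a2 ⟨w, w1, w2⟩
        refine ⟨w, by rw [hpc _ a2]; rwa [hpc _ a1] at w1, ?_⟩
        have := hd.tri y₂ y₁ w
        have := dball y₂ y₁ a2 a1
        omega
      by_cases hB : ∃ y₀, d x y₀ ≤ R ∧ ¬ T L y₀
      · obtain ⟨y₀, b1, b2⟩ := hB
        have hr : ∀ y, d x y ≤ R → ¬ (T L y ∧ T ((c y + 1) * ρ) y) := by
          rintro y hy ⟨hT, hT'⟩
          have hc := h1 y hT
          refine b2 (Tmono _ _ _ ?_ (Ttr _ y y₀ hy b1 hT'))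
          have : (c y + 1) * ρ ≤ n * ρ := Nat.mul_le_mul_right _ hc
          have : L = n * ρ + ρ := by rw [hL]; ring
          omega
        refine ⟨fun y => cp (piece x) (q y), fun y hy => g1 (piece x) (q y) ((hqp y).trans (hpc y hy)), ?_⟩
        intro y₁ y₂ a1 a2 hc
        rw [Φr _ (hr _ a1), Φr _ (hr _ a2), hpc _ a1, hpc _ a2]
        simp only at hc
        have t0 : d (q y₁) (q y₂) ≤ 2 * R + 2 * D := by
          have t1 := hd.tri (q y₁) y₁ (q y₂)
          have t2 := hd.tri y₁ y₂ (q y₂)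
          have t3 := hd.symm y₁ (q y₁)
          have t4 := hqd y₁
          have t5 := hqd y₂
          have t6 := dball _ _ a1 a2
          omega
        rw [hc, g2 (piece x) (q y₁) ((hqp y₁).trans (hpc _ a1)) (q y₂) ((hqp y₂).trans (hpc _ a2)) t0 hc]
      · push Not at hB
        let St : ℕ → Prop := fun j => ∃ y, d x y ≤ R ∧ c y = j ∧ T ((j + 1) * ρ) y
        have key : ∀ y₁ y₂, d x y₁ ≤ R → d x y₂ ≤ R → St (c y₁) → ¬ T ((c y₁ + 1) * ρ) y₁ →
            St (c y₂) → ¬ T ((c y₂ + 1) * ρ) y₂ → c y₁ < c y₂ → False := by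
          rintro y₁ y₂ a1 a2 ⟨z, z1, z2, z3⟩ n1 s2 n2 hlt
          refine n2 (Tmono _ _ _ ?_ (Ttr _ z y₂ z1 a2 z3))
          have : (c y₁ + 1 + 1) * ρ ≤ (c y₂ + 1) * ρ := Nat.mul_le_mul_right _ (by omega)
          have : (c y₁ + 1 + 1) * ρ = (c y₁ + 1) * ρ + ρ := by ring
          omega
        refine ⟨fun y => if St (c y) ∧ ¬ T ((c y + 1) * ρ) y then n else c y, ?_, ?_⟩
        · intro y hy
          have := h1 y (hB y hy)
          simp only
          split_ifs <;> omega
        · intro y₁ y₂ a1 a2 hc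
          have c1 := h1 y₁ (hB y₁ a1)
          have c2 := h1 y₂ (hB y₂ a2)
          have fin : c y₁ = c y₂ → (T ((c y₁ + 1) * ρ) y₁ ↔ T ((c y₂ + 1) * ρ) y₂) → Φ y₁ = Φ y₂ := by
            intro e1 e2
            have el := h2 y₁ (hB y₁ a1) y₂ (hB y₂ a2) (dball _ _ a1 a2) e1
            by_cases hT : T ((c y₁ + 1) * ρ) y₁
            · rw [Φl y₁ ⟨hB y₁ a1, hT⟩, Φl y₂ ⟨hB y₂ a2, e2.1 hT⟩, e1, el]
            · rw [Φr y₁ (fun h => hT h.2), Φr y₂ (fun h => hT (e2.2 h.2))]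
              have : q y₁ = q y₂ := by
                simp only [q]
                rw [if_pos (hB y₁ a1), if_pos (hB y₂ a2), e1, el, hpc _ a1, hpc _ a2]
              rw [this, hpc _ a1, hpc _ a2]
          simp only at hc
          split_ifs at hc with i1 i2 i2
          · rcases lt_trichotomy (c y₁) (c y₂) with hlt | heq | hgt
            · exact (key y₁ y₂ a1 a2 i1.1 i1.2 i2.1 i2.2 hlt).elim
            · exact fin heq ⟨fun h => (i1.2 h).elim, fun h => (i2.2 h).elim⟩
            · exact (key y₂ y₁ a2 a1 i2.1 i2.2 i1.1 i1.2 hgt).elim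
          · omega
          · omega
          · refine fin hc ⟨fun h => ?_, fun h => ?_⟩
            · by_contra hn
              exact i2 ⟨⟨y₁, a1, hc, by rwa [← hc]⟩, hn⟩
            · by_contra hn
              exact i1 ⟨⟨y₂, a2, hc.symm, by rwa [hc]⟩, hn⟩

end Col
end AsdimGG
namespace AsdimGG

def Anc {V : Type} (par : V → V) (u a : V) : Prop := ∃ k, par^[k] a = u

structure TSp (X V : Type) where
  d : X → X → ℕ
  pm : PM d
  π : X → V
  par : V → V
  δ : V → ℕ
  δ_par : ∀ u, δ (par u) = δ u - 1
  δ_root : ∀ u w, δ u = 0 → δ w = 0 → u = w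
  C : V → Set X
  C_π : ∀ u, ∀ z ∈ C u, π z = u
  C_par : ∀ u, 0 < δ u → ∀ z ∈ C u, ∃ z', π z' = par u ∧ d z z' ≤ 1
  gate : ∀ u, 0 < δ u → ∀ x y, Anc par u (π x) → ¬ Anc par u (π y) → ∃ z ∈ C u, d x z ≤ d x y
  lip : ∀ x y, δ (π x) ≤ δ (π y) + d x y

namespace TSp
variable {X V : Type} (S : TSp X V)

lemma δ_iter (k : ℕ) (a : V) : S.δ (S.par^[k] a) = S.δ a - k := by
  induction k with
  | zero => simp
  | succ k ih => rw [Function.iterate_succ_apply', S.δ_par, ih]; omega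

lemma anc_refl (a : V) : Anc S.par a a := ⟨0, rfl⟩

lemma anc_trans {a b c : V} (h : Anc S.par a b) (h' : Anc S.par b c) : Anc S.par a c := by
  obtain ⟨k, rfl⟩ := h
  obtain ⟨k', rfl⟩ := h'
  exact ⟨k + k', by rw [Function.iterate_add_apply]⟩

lemma anc_le {a b : V} (h : Anc S.par a b) : S.δ a ≤ S.δ b := by
  obtain ⟨k, rfl⟩ := h
  rw [S.δ_iter]; omega

lemma anc_unique {a b c : V} (h : Anc S.par a c) (h' : Anc S.par b c) (he : S.δ a = S.δ b) :
    a = b := by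
  by_cases h0 : S.δ a = 0
  · exact S.δ_root a b h0 (he ▸ h0)
  obtain ⟨k, rfl⟩ := h
  obtain ⟨k', rfl⟩ := h'
  rw [S.δ_iter, S.δ_iter] at he
  rw [S.δ_iter] at h0
  rw [show k = k' by omega]

lemma anc_exists (a : V) {m : ℕ} (hm : m ≤ S.δ a) : ∃ u, Anc S.par u a ∧ S.δ u = m :=
  ⟨S.par^[S.δ a - m] a, ⟨_, rfl⟩, by rw [S.δ_iter]; omega⟩

lemma anc_par {u a : V} (h : Anc S.par u a) (hlt : S.δ u < S.δ a) : Anc S.par u (S.par a) := by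
  obtain ⟨k, rfl⟩ := h
  cases k with
  | zero => simp at hlt
  | succ k => exact ⟨k, by rw [← Function.iterate_succ_apply]⟩

def F (u : V) (m : ℕ) : Set X := {x | Anc S.par u (S.π x) ∧ S.δ (S.π x) ≤ S.δ u + m}

lemma col_F {k : ℕ} (hnode : ∀ R, ∃ B, ∀ u, Col S.d k {x | S.π x = u} R B) (m : ℕ) :
    ∀ R, ∃ B, ∀ u, Col S.d k (S.F u m) R B := by
  induction m with
  | zero =>
    intro R
    obtain ⟨B, hB⟩ := hnode R
    refine ⟨B, fun u => (hB u).subset ?_⟩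
    rintro x ⟨h1, h2⟩
    have := S.anc_le h1
    exact (S.anc_unique h1 (S.anc_refl _) (by omega)).symm
  | succ m ih =>
    intro R
    obtain ⟨B0, hB0⟩ := hnode R
    obtain ⟨B1, hB1⟩ := ih (B0 + 2 * R + 2 * (R + 1))
    refine ⟨B1 + 2 * (R + 1) + 2 * (B0 + R), fun u => ?_⟩
    have hA' := Col.nbhd S.pm (R + 1) (hB1 u)
    have hA : Col S.d k {x | Anc S.par u (S.π x) ∧ S.δ (S.π x) = S.δ u + m + 1 ∧
        ∀ z ∈ S.C (S.π x), R < S.d x z} R B0 := by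
      choose c l h1 h2 h3 using hB0
      refine Col.of_label (fun x => c (S.π x) x) (fun x => (S.π x, l (S.π x) x)) ?_ ?_ ?_
      · intro x _
        exact h1 _ x rfl
      · rintro x ⟨x1, x2, x3⟩ y ⟨y1, y2, y3⟩ hxy hc
        have he : S.π x = S.π y := by
          by_contra hne
          obtain ⟨z, hz, hz'⟩ := S.gate (S.π x) (by omega) x y (S.anc_refl _) (by
            intro h
            exact hne (S.anc_unique h (S.anc_refl _) (by omega)))
          have := x3 z hz
          omega
        rw [he] at hc
        simp only [he]
        rw [h2 (S.π y) x he y rfl hxy hc]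
      · rintro x - y - hc hl
        simp only [Prod.mk.injEq] at hl
        obtain ⟨e1, e2⟩ := hl
        rw [e1] at hc e2
        exact h3 (S.π y) x e1 y rfl hc e2
    refine Col.union S.pm hA hA' ?_
    rintro x ⟨x1, x2⟩
    by_cases hx : S.δ (S.π x) ≤ S.δ u + m
    · right
      exact ⟨x, ⟨x1, hx⟩, by rw [S.pm.self]; omega⟩
    · by_cases hz : ∀ z ∈ S.C (S.π x), R < S.d x z
      · left
        exact ⟨x1, by omega, hz⟩
      · right
        push Not at hz
        obtain ⟨z, hz, hd⟩ := hz
        obtain ⟨z', hz', hd'⟩ := S.C_par (S.π x) (by omega) z hz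
        refine ⟨z', ⟨?_, ?_⟩, ?_⟩
        · rw [hz']
          exact S.anc_par x1 (by omega)
        · rw [hz', S.δ_par]; omega
        · have := S.pm.tri x z z'
          omega

theorem main (n : ℕ) (hnode : ∀ R, ∃ B, ∀ u, Col S.d (n + 1) {x | S.π x = u} R B)
    (hgate : ∀ R, ∃ B, ∀ u, 0 < S.δ u → Col S.d n (S.C u) R B) (R : ℕ) :
    ∃ B, ∃ (J : Type) (Φ : X → J), (∀ x y, Φ x = Φ y → S.d x y ≤ B) ∧
      ∀ x, ∃ code : X → ℕ, (∀ y, S.d x y ≤ R → code y < n + 1) ∧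
        ∀ y₁ y₂, S.d x y₁ ≤ R → S.d x y₂ ≤ R → code y₁ = code y₂ → Φ y₁ = Φ y₂ := by
  classical
  set L := (n + 1) * (2 * R + 1) with hL
  obtain ⟨s, hs⟩ : ∃ s, s = L + 2 * R + 1 := ⟨_, rfl⟩
  obtain ⟨N, hN⟩ : ∃ N, N = s + L + 1 := ⟨_, rfl⟩
  obtain ⟨D0, hD0⟩ := hgate (2 * R + 2 * (s + L))
  obtain ⟨D, hD⟩ : ∃ D, D = D0 + 2 * (s + L) := ⟨_, rfl⟩
  obtain ⟨B, hB⟩ := S.col_F hnode (2 * N) (2 * R + 2 * D)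
  -- the half space of u
  let H : V → X → Prop := fun u x => N ∣ S.δ u ∧ Anc S.par u (S.π x) ∧
    (0 < S.δ u → ∀ z ∈ S.C u, s ≤ S.d x z)
  -- if x is deep beneath u then it is far from C u
  have far : ∀ u x m, S.δ u + m ≤ S.δ (S.π x) → ∀ z ∈ S.C u, m ≤ S.d x z := by
    intro u x m h z hz
    have := S.lip x z
    rw [S.C_π u z hz] at this
    omega
  have hpiece : ∀ x, ∃ p, H p x ∧ S.δ (S.π x) ≤ S.δ p + 2 * N ∧ ∀ u, H u x → S.δ u ≤ S.δ p := by
    intro x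
    have hNpos : 0 < N := by omega
    have hk : N * (S.δ (S.π x) / N) ≤ S.δ (S.π x) := Nat.mul_div_le _ _
    have hk' : S.δ (S.π x) < N * (S.δ (S.π x) / N) + N := by
      have := Nat.lt_mul_div_succ (S.δ (S.π x)) hNpos
      rwa [Nat.mul_succ] at this
    set k := S.δ (S.π x) / N with hkdef
    have hmax : ∀ u, H u x → S.δ u ≤ N * k := by
      rintro u ⟨⟨j, hj⟩, h2, -⟩
      have h3 := S.anc_le h2
      rw [hj]
      refine Nat.mul_le_mul_left _ ?_
      rw [hkdef, Nat.le_div_iff_mul_le hNpos, mul_comm, ← hj]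
      exact h3
    obtain ⟨u, hu, huδ⟩ := S.anc_exists (S.π x) hk
    by_cases hH : H u x
    · exact ⟨u, hH, by omega, fun w hw => by rw [huδ]; exact hmax w hw⟩
    · have hk0 : k ≠ 0 := by
        intro h0
        refine hH ⟨?_, hu, ?_⟩
        · rw [huδ]; exact Dvd.intro _ rfl
        · intro h; rw [huδ, h0] at h; simp at h
      obtain ⟨j, hj⟩ := Nat.exists_eq_succ_of_ne_zero hk0
      have hjk : N * k = N * j + N := by rw [hj, Nat.mul_succ]
      obtain ⟨p, hp, hpδ⟩ := S.anc_exists (S.π x) (m := N * j) (by omega)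
      refine ⟨p, ⟨?_, hp, fun _ => ?_⟩, by omega, ?_⟩
      · rw [hpδ]; exact Dvd.intro _ rfl
      · intro z hz
        exact far p x s (by omega) z hz
      · intro w hw
        have h1 := hmax w hw
        obtain ⟨⟨i, hi⟩, h2, -⟩ := id hw
        have hik : i ≤ k := by
          rw [hi] at h1
          exact Nat.le_of_mul_le_mul_left h1 hNpos
        rcases Nat.lt_or_ge i k with hlt | hge
        · rw [hi, hpδ]
          exact Nat.mul_le_mul_left _ (by omega)
        · exfalso
          have : w = u := S.anc_unique h2 hu (by rw [hi, huδ, show i = k by omega])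
          rw [this] at hw
          exact hH hw
  choose piece hp1 hp2 hp3 using hpiece
  let K : V → Set X := fun u => {x | Anc S.par u (S.π x) ∧ (∀ z ∈ S.C u, s ≤ S.d x z + L) ∧
    ∃ z ∈ S.C u, S.d x z ≤ s + L}
  have hK : ∀ x, (∃ y, piece y ≠ piece x ∧ S.d x y ≤ L) →
      ∃ u, 0 < S.δ u ∧ N ∣ S.δ u ∧ x ∈ K u := by
    rintro x ⟨y, hne, hxy⟩
    have hor : ¬ (H (piece y) x ∧ H (piece x) y) := by
      rintro ⟨a, b⟩
      refine hne (S.anc_unique a.2.1 (hp1 x).2.1 ?_)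
      have := hp3 x _ a
      have := hp3 y _ b
      omega
    have hpos : ∀ (w : V) (a b : X), H w a → ¬ H w b → 0 < S.δ w := by
      intro w a b h1 h2
      by_contra h0
      refine h2 ⟨h1.1, ?_, fun h => (h0 h).elim⟩
      obtain ⟨r, hr, hr'⟩ := S.anc_exists (S.π b) (Nat.zero_le _)
      rwa [S.δ_root w r (by omega) hr']
    by_cases hyx : H (piece x) y
    · -- x is not in the half space of q
      have hxq : ¬ H (piece y) x := fun h => hor ⟨h, hyx⟩
      have hyq := hp1 y
      have pos := hpos _ _ _ hyq hxq
      refine ⟨piece y, pos, hyq.1, ?_⟩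
      have hanc : Anc S.par (piece y) (S.π x) := by
        by_contra hna
        obtain ⟨z, hz, hz'⟩ := S.gate _ pos y x hyq.2.1 hna
        have := hyq.2.2 pos z hz
        have := S.pm.symm x y
        omega
      have hlt : ∃ z ∈ S.C (piece y), S.d x z < s := by
        by_contra! hcon
        exact hxq ⟨hyq.1, hanc, fun _ => hcon⟩
      refine ⟨hanc, ?_, ?_⟩
      · intro z hz
        have := hyq.2.2 pos z hz
        have := S.pm.tri y x z
        have := S.pm.symm x y
        omega
      · obtain ⟨z, hz, h⟩ := hlt
        exact ⟨z, hz, by omega⟩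
    · have hxp := hp1 x
      have pos := hpos _ _ _ hxp hyx
      refine ⟨piece x, pos, hxp.1, hxp.2.1, ?_, ?_⟩
      · intro z hz
        have := hxp.2.2 pos z hz
        omega
      · have hanc : Anc S.par (piece x) (S.π y) := by
          by_contra hna
          obtain ⟨z, hz, hz'⟩ := S.gate _ pos x y hxp.2.1 hna
          have := hxp.2.2 pos z hz
          omega
        have hlt : ∃ z ∈ S.C (piece x), S.d y z < s := by
          by_contra! hcon
          exact hyx ⟨hxp.1, hanc, fun _ => hcon⟩
        obtain ⟨z, hz, h⟩ := hlt
        refine ⟨z, hz, ?_⟩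
        have := S.pm.tri x y z
        omega
  -- separation of the collars
  have hsep : ∀ u w x y, 0 < S.δ u → 0 < S.δ w → N ∣ S.δ u → N ∣ S.δ w → x ∈ K u → y ∈ K w →
      S.d x y ≤ 2 * R → u = w := by
    intro u w x y pu pw du dw hx hy hxy
    have h1 : Anc S.par u (S.π y) := by
      by_contra hna
      obtain ⟨z, hz, hz'⟩ := S.gate _ pu x y hx.1 hna
      have := hx.2.1 z hz
      omega
    have h2 : Anc S.par w (S.π x) := by
      by_contra hna
      obtain ⟨z, hz, hz'⟩ := S.gate _ pw y x hy.1 hna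
      have := hy.2.1 z hz
      have := S.pm.symm x y
      omega
    have key : ∀ a b, N ∣ a → N ∣ b → a < b → a + N ≤ b := by
      rintro a b ⟨i, rfl⟩ ⟨j, rfl⟩ hab
      have hij : i < j := lt_of_mul_lt_mul_left' hab
      calc N * i + N = N * (i + 1) := by ring
        _ ≤ N * j := Nat.mul_le_mul_left _ hij
    have a1 := S.anc_le h1
    have a2 := S.anc_le h2
    rcases lt_trichotomy (S.δ u) (S.δ w) with hlt | heq | hgt
    · have := key _ _ du dw hlt
      obtain ⟨z, hz, hz'⟩ := hx.2.2
      have := far u x N (by omega) z hz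
      omega
    · exact S.anc_unique hx.1 h2 heq
    · have := key _ _ dw du hgt
      obtain ⟨z, hz, hz'⟩ := hy.2.2
      have := far w y N (by omega) z hz
      omega
  have hKcol : ∀ u, 0 < S.δ u → Col S.d n (K u) (2 * R) D := by
    intro u hu
    rw [hD]
    exact (Col.nbhd S.pm (s + L) (hD0 u hu)).subset (fun x hx => hx.2.2)
  have hW : Col S.d n {x | ∃ y, piece y ≠ piece x ∧ S.d x y ≤ L} (2 * R) D := by
    have hK' : ∀ x, ∃ u, (∃ y, piece y ≠ piece x ∧ S.d x y ≤ L) → 0 < S.δ u ∧ N ∣ S.δ u ∧ x ∈ K u := by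
      intro x
      by_cases h : ∃ y, piece y ≠ piece x ∧ S.d x y ≤ L
      · obtain ⟨u, hu⟩ := hK x h
        exact ⟨u, fun _ => hu⟩
      · exact ⟨S.π x, fun h' => (h h').elim⟩
    choose U hU using hK'
    choose c l h1 h2 h3 using hKcol
    let c' : V → X → ℕ := fun u x => if h : 0 < S.δ u then c u h x else 0
    let l' : V → X → X := fun u x => if h : 0 < S.δ u then l u h x else x
    refine Col.of_label (fun x => c' (U x) x) (fun x => (U x, l' (U x) x)) ?_ ?_ ?_
    · intro x hx
      obtain ⟨a1, a2, a3⟩ := hU x hx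
      simp only [c', a1, dif_pos]
      exact h1 _ _ x a3
    · intro x hx y hy hxy hc
      obtain ⟨a1, a2, a3⟩ := hU x hx
      obtain ⟨b1, b2, b3⟩ := hU y hy
      have he := hsep _ _ x y a1 b1 a2 b2 a3 b3 hxy
      rw [he] at a3
      simp only [he, c', b1, dif_pos] at hc
      simp only [he, l', b1, dif_pos]
      rw [h2 _ _ x a3 y b3 hxy hc]
    · intro x hx y hy hc hl
      obtain ⟨a1, a2, a3⟩ := hU x hx
      obtain ⟨b1, b2, b3⟩ := hU y hy
      simp only [Prod.mk.injEq] at hl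
      obtain ⟨he, hl⟩ := hl
      rw [he] at a3
      simp only [he, c', b1, dif_pos] at hc
      simp only [he, l', b1, dif_pos] at hl
      exact h3 _ _ x a3 y b3 hc hl
  have hP : ∀ p, Col S.d (n + 1) {x | piece x = p} (2 * R + 2 * D) B := by
    intro p
    refine (hB p).subset ?_
    rintro x rfl
    exact ⟨(hp1 x).2.1, hp2 x⟩
  exact ⟨_, partition_thm S.pm n R D B piece hW hP⟩

end TSp
end AsdimGG
namespace AsdimGG

lemma rec_exists {ι H : Type} [Mul H] [One H] (v0 : ι) (δ : ι → ℕ) (p : ι → ι) (g : ι → H)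
    (hp : ∀ v, v ≠ v0 → δ (p v) < δ v) : ∃ θ : ι → H, ∀ v, v ≠ v0 → θ v = θ (p v) * g v := by
  classical
  let Fn : ∀ v : ι, (∀ w, δ w < δ v → H) → H := fun v rec =>
    if h : v = v0 then 1 else rec (p v) (hp v h) * g v
  refine ⟨(measure δ).wf.fix Fn, fun v hv => ?_⟩
  rw [WellFounded.fix_eq]
  simp only [Fn, hv, dif_neg, not_false_eq_true]

lemma tree_triv {ι ε : Type} [Finite ι] [Finite ε] (ends : ε → ι × ι) (T : Set ε)
    (hconn : ∀ a b : ι,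
      Relation.ReflTransGen (fun a b : ι => ∃ e ∈ T, ends e = (a, b) ∨ ends e = (b, a)) a b)
    (htree : Nat.card T + 1 = Nat.card ι) {H : Type} [Group H] (f : ε → H) :
    ∃ θ : ι → H, ∀ e ∈ T, θ (ends e).2 * f e = θ (ends e).1 := by
  classical
  have hne : Nonempty ι := by
    by_contra h
    rw [not_nonempty_iff] at h
    have h0 : Nat.card ι = 0 := Nat.card_of_isEmpty
    omega
  obtain ⟨v0⟩ := hne
  let r : ι → ι → Prop := fun a b : ι => ∃ e ∈ T, ends e = (a, b) ∨ ends e = (b, a)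
  let Gr : SimpleGraph ι := SimpleGraph.fromRel r
  have hadj : ∀ a b, Gr.Adj a b → r a b := by
    intro a b h
    rw [SimpleGraph.fromRel_adj] at h
    rcases h.2 with h | ⟨e, he, h⟩
    · exact h
    · exact ⟨e, he, h.symm⟩
  have hreach : ∀ a b, Gr.Reachable a b := by
    intro a b
    induction hconn a b with
    | refl => exact SimpleGraph.Reachable.refl _
    | @tail b c _ hbc ih =>
      by_cases h : b = c
      · rw [← h]; exact ih
      · exact ih.trans (SimpleGraph.Adj.reachable ((SimpleGraph.fromRel_adj _ _ _).2 ⟨h, Or.inl hbc⟩))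
  let δ : ι → ℕ := fun v => Gr.dist v v0
  have hpar : ∀ v : {v // v ≠ v0}, ∃ q : ι × T, δ q.1 < δ v.1 ∧
      (ends q.2 = (q.1, v.1) ∨ ends q.2 = (v.1, q.1)) := by
    rintro ⟨v, hv⟩
    obtain ⟨w, hw⟩ := (hreach v v0).exists_walk_length_eq_dist
    cases w with
    | nil => exact (hv rfl).elim
    | @cons _ u _ h p =>
      obtain ⟨e, he, h'⟩ := hadj _ _ h
      refine ⟨(u, ⟨e, he⟩), ?_, h'.symm⟩
      have := SimpleGraph.dist_le p
      simp only [SimpleGraph.Walk.length_cons] at hw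
      simp only [δ]
      omega
  choose q hq1 hq2 using hpar
  have hinj : Function.Injective (fun v => (q v).2) := by
    intro v v' h
    simp only at h
    have a1 := hq2 v
    have a2 := hq2 v'
    rw [h] at a1
    have b1 := hq1 v
    have b2 := hq1 v'
    apply Subtype.ext
    rcases a1 with a1 | a1 <;> rcases a2 with a2 | a2 <;> rw [a1, Prod.mk.injEq] at a2 <;>
      obtain ⟨c1, c2⟩ := a2
    · exact c2
    · rw [c1] at b1; rw [← c2] at b2; omega
    · rw [c2] at b1; rw [← c1] at b2; omega
    · exact c1
  have hcard : Nat.card T ≤ Nat.card {v // v ≠ v0} := by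
    have h1 : Nat.card {v // v ≠ v0} + 1 = Nat.card ι := by
      have := Fintype.ofFinite ι
      rw [Nat.card_eq_fintype_card, Nat.card_eq_fintype_card, Fintype.card_subtype_compl]
      simp
      have : 0 < Fintype.card ι := Fintype.card_pos_iff.2 ⟨v0⟩
      omega
    omega
  have hsurj := (hinj.bijective_of_nat_card_le hcard).2
  obtain ⟨θ, hθ⟩ := rec_exists v0 δ (fun v => if h : v ≠ v0 then (q ⟨v, h⟩).1 else v)
    (fun v => if h : v ≠ v0 then (if ends (q ⟨v, h⟩).2 = ((q ⟨v, h⟩).1, v) then (f (q ⟨v, h⟩).2)⁻¹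
      else f (q ⟨v, h⟩).2) else 1)
    (fun v hv => by simp only [hv, ne_eq, not_false_eq_true, dif_pos]; exact hq1 ⟨v, hv⟩)
  refine ⟨θ, fun e he => ?_⟩
  obtain ⟨⟨v, hv⟩, hve⟩ := hsurj ⟨e, he⟩
  have h1 := hθ v hv
  simp only [hv, ne_eq, not_false_eq_true, dif_pos] at h1
  simp only at hve
  have h2 := hq2 ⟨v, hv⟩
  rw [hve] at h1 h2
  simp only at h1 h2
  by_cases h3 : ends e = ((q ⟨v, hv⟩).1, v)
  · rw [if_pos h3] at h1
    rw [h3]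
    simp only
    rw [h1]; group
  · rw [if_neg h3] at h1
    rw [h2.resolve_left h3]
    simp only
    rw [h1]

lemma fg_countable (G : Type) [Group G] [hfg : Group.FG G] : Countable G := by
  obtain ⟨S, hS⟩ := Group.fg_def.1 hfg
  have : (Set.univ : Set G).Countable := by
    refine Set.Countable.mono ?_ (Set.countable_iUnion
      (fun R : ℕ => (wb_finite S.finite_toSet R (1 : G)).countable))
    intro g _
    obtain ⟨R, hR⟩ := wb_exh hS g
    exact Set.mem_iUnion.2 ⟨R, hR⟩
  exact Set.countable_univ_iff.1 this

/-- free `K`-sets -/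
lemma free_iso {K G : Type} [Group K] [Group G] [Countable G] (j : K →* G)
    (hj : Function.Injective j) :
    ∃ σ : K × ℕ ≃ G × ℕ, ∀ x p, σ (x * p.1, p.2) = (j x * (σ p).1, (σ p).2) := by
  classical
  let Q := Quotient (QuotientGroup.rightRel j.range)
  have : Countable Q := Quotient.countable
  have : Nonempty Q := ⟨Quotient.mk _ 1⟩
  obtain ⟨enc⟩ := nonempty_equiv_of_countable (α := ℕ) (β := Q × ℕ)
  let s : K × (Q × ℕ) → G × ℕ := fun p => (j p.1 * p.2.1.out, p.2.2)
  have hs : Function.Bijective s := by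
    constructor
    · rintro ⟨x, q, k⟩ ⟨x', q', k'⟩ h
      simp only [s, Prod.mk.injEq] at h
      obtain ⟨h1, rfl⟩ := h
      have hq : q = q' := by
        rw [← q.out_eq, ← q'.out_eq]
        apply Quotient.sound
        change (QuotientGroup.rightRel j.range).r _ _
        rw [← QuotientGroup.rightRel_apply.symm.eq] 
        refine ⟨x'⁻¹ * x, ?_⟩
        rw [map_mul, map_inv, eq_mul_inv_iff_mul_eq, mul_assoc, h1]; group
      subst hq
      rw [hj (mul_right_cancel h1)]
    · rintro ⟨g, k⟩
      have h1 : (QuotientGroup.rightRel j.range).r (Quotient.mk (QuotientGroup.rightRel j.range) g).out g :=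
        Quotient.mk_out g
      have h2 := QuotientGroup.rightRel_apply.1 h1
      obtain ⟨x, hx⟩ := h2
      refine ⟨(x, Quotient.mk _ g, k), ?_⟩
      simp only [s, hx, Prod.mk.injEq, and_true]
      group
  refine ⟨(Equiv.prodCongr (Equiv.refl K) enc).trans (Equiv.ofBijective s hs), ?_⟩
  rintro x ⟨y, m⟩
  simp [s, mul_assoc]

lemma perm_act (G : Type) [Group G] [Countable G] : ∃ α : G →* Equiv.Perm ℕ,
    Function.Injective α ∧ ∀ (K : Type) [Group K] (j : K →* G), Function.Injective j →
      ∃ σ : K × ℕ ≃ ℕ, ∀ x p, σ (x * p.1, p.2) = α (j x) (σ p) := by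
  obtain ⟨enc⟩ := nonempty_equiv_of_countable (α := G × ℕ) (β := ℕ)
  let α : G →* Equiv.Perm ℕ := MonoidHom.mk'
    (fun g => enc.symm.trans ((Equiv.prodCongr (Equiv.mulLeft g) (Equiv.refl ℕ)).trans enc))
    (by
      intro a b
      apply Equiv.ext
      intro n
      obtain ⟨p, rfl⟩ := enc.surjective n
      obtain ⟨g, k⟩ := p
      simp [mul_assoc])
  have hα : ∀ g p, α g (enc p) = enc (g * p.1, p.2) := by
    rintro g ⟨h, m⟩
    simp [α]
  refine ⟨α, ?_, ?_⟩
  · intro a b h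
    have := congrArg (fun s : Equiv.Perm ℕ => s (enc (1, 0))) h
    simp only [hα] at this
    simpa using this
  · intro K _ j hj
    obtain ⟨σ, hσ⟩ := free_iso j hj
    refine ⟨σ.trans enc, ?_⟩
    intro x p
    simp only [Equiv.trans_apply]
    rw [hσ, hα]

structure IsPi1 {ι ε : Type} (ends : ε → ι × ι)
    (Gv : ι → Type) [∀ i, Group (Gv i)] (Ge : ε → Type) [∀ e, Group (Ge e)]
    (ini : ∀ e, Ge e →* Gv (ends e).1) (ter : ∀ e, Ge e →* Gv (ends e).2) (T : Set ε)
    (Γ : Type) [Group Γ] (φ : ∀ v, Gv v →* Γ) (t : ε → Γ) : Prop where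
  rel : ∀ e x, t e * φ _ (ini e x) * (t e)⁻¹ = φ _ (ter e x)
  tT : ∀ e ∈ T, t e = 1
  gen : Subgroup.closure ((⋃ v, Set.range (φ v)) ∪ Set.range t) = ⊤
  univ : ∀ (H : Type) [Group H] (ψ : ∀ v, Gv v →* H) (s : ε → H),
    (∀ e x, s e * ψ _ (ini e x) * (s e)⁻¹ = ψ _ (ter e x)) → (∀ e ∈ T, s e = 1) →
    ∃ Ψ : Γ →* H, (∀ v x, Ψ (φ v x) = ψ v x) ∧ ∀ e, Ψ (t e) = s e

section BS
variable {ι ε : Type} [Finite ι] [Finite ε] {ends : ε → ι × ι}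
    {Gv : ι → Type} [∀ i, Group (Gv i)] {Ge : ε → Type} [∀ e, Group (Ge e)]
    {ini : ∀ e, Ge e →* Gv (ends e).1} {ter : ∀ e, Ge e →* Gv (ends e).2} {T : Set ε}
    {Γ : Type} [Group Γ] {φ : ∀ v, Gv v →* Γ} {t : ε → Γ}

lemma IsPi1.inj [∀ i, Countable (Gv i)] (h : IsPi1 ends Gv Ge ini ter T Γ φ t)
    (hini : ∀ e, Function.Injective (ini e)) (hter : ∀ e, Function.Injective (ter e))
    (hconn : ∀ a b : ι,
      Relation.ReflTransGen (fun a b : ι => ∃ e ∈ T, ends e = (a, b) ∨ ends e = (b, a)) a b)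
    (htree : Nat.card T + 1 = Nat.card ι) (v : ι) : Function.Injective (φ v) := by
  choose α hα hσ using fun v => perm_act (Gv v)
  choose σ1 hσ1 using fun e => hσ (ends e).1 (Ge e) (ini e) (hini e)
  choose σ2 hσ2 using fun e => hσ (ends e).2 (Ge e) (ter e) (hter e)
  let τ : ε → Equiv.Perm ℕ := fun e => (σ1 e).symm.trans (σ2 e)
  have hτ : ∀ e x, τ e * α _ (ini e x) = α _ (ter e x) * τ e := by
    intro e x
    ext y
    obtain ⟨p, rfl⟩ := (σ1 e).surjective y
    simp only [Equiv.Perm.mul_apply, ← hσ1, τ, Equiv.trans_apply, Equiv.symm_apply_apply, hσ2]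
  obtain ⟨θ, hθ⟩ := tree_triv ends T hconn htree τ
  obtain ⟨Ψ, hΨ, -⟩ := h.univ (Equiv.Perm ℕ)
    (fun v => ((MulAut.conj (θ v)).toMonoidHom).comp (α v))
    (fun e => θ (ends e).2 * τ e * (θ (ends e).1)⁻¹)
    (by
      intro e x
      simp only [MonoidHom.comp_apply, MulEquiv.coe_toMonoidHom, MulAut.conj_apply]
      have := hτ e x
      calc _ = θ (ends e).2 * (τ e * α _ (ini e x)) * (τ e)⁻¹ * (θ (ends e).2)⁻¹ := by group
        _ = _ := by rw [this]; group)
    (by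
      intro e he
      rw [hθ e he]; group)
  intro x y hxy
  have h1 := hΨ v x
  have h2 := hΨ v y
  rw [hxy, h2] at h1
  simp only [MonoidHom.comp_apply, MulEquiv.coe_toMonoidHom] at h1
  exact (hα v ((MulAut.conj (θ v)).injective h1)).symm

def PP (γ : Γ) (b : Γ → ZMod 2) : Equiv.Perm (Γ × ZMod 2) where
  toFun p := (p.1 * γ⁻¹, p.2 + b p.1)
  invFun p := (p.1 * γ, p.2 - b (p.1 * γ))
  left_inv p := by simp
  right_inv p := by simp

lemma IsPi1.cocycle (h : IsPi1 ends Gv Ge ini ter T Γ φ t)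
    (hconn : ∀ a b : ι,
      Relation.ReflTransGen (fun a b : ι => ∃ e ∈ T, ends e = (a, b) ∨ ends e = (b, a)) a b)
    (htree : Nat.card T + 1 = Nat.card ι) (e0 : ε) (g0 : Γ) :
    ∃ Q : Γ → ι → ZMod 2, (∀ g v x, Q (g * φ v x) v = Q g v) ∧
      (∀ e g, (e = e0 ∧ ∃ x, g = g0 * φ _ (ini e x)) →
        Q (g * (t e)⁻¹) (ends e).2 = Q g (ends e).1 + 1) ∧
      (∀ e g, ¬ (e = e0 ∧ ∃ x, g = g0 * φ _ (ini e x)) →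
        Q (g * (t e)⁻¹) (ends e).2 = Q g (ends e).1) := by
  classical
  let f : ε → Γ → ZMod 2 := fun e g => if e = e0 ∧ ∃ x, g = g0 * φ _ (ini e x) then 1 else 0
  have hf : ∀ e g x, f e (g * (φ _ (ini e x))⁻¹) = f e g := by
    intro e g x
    have : (e = e0 ∧ ∃ y, g * (φ _ (ini e x))⁻¹ = g0 * φ _ (ini e y)) ↔
        (e = e0 ∧ ∃ y, g = g0 * φ _ (ini e y)) := by
      refine and_congr_right fun _ => ⟨?_, ?_⟩
      · rintro ⟨y, hy⟩
        refine ⟨y * x, ?_⟩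
        rw [mul_inv_eq_iff_eq_mul] at hy
        rw [hy]; simp [mul_assoc]
      · rintro ⟨y, hy⟩
        refine ⟨y * x⁻¹, ?_⟩
        rw [hy]; simp [mul_assoc]
    simp only [f, this]
  obtain ⟨κ', hκ'⟩ := tree_triv ends T hconn htree
    (H := Multiplicative (Γ → ZMod 2)) (fun e => Multiplicative.ofAdd (f e))
  obtain ⟨κ, hκ⟩ : ∃ κ : ι → Γ → ZMod 2, ∀ e ∈ T, ∀ g, κ (ends e).2 g + f e g = κ (ends e).1 g :=
    ⟨fun v => Multiplicative.toAdd (κ' v), fun e he g =>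
      congrFun (congrArg Multiplicative.toAdd (hκ' e he)) g⟩
  obtain ⟨Ψ, hΨ, hΨt⟩ := h.univ (Equiv.Perm (Γ × ZMod 2))
    (fun v => MonoidHom.mk' (fun x => PP (φ v x) (fun g => κ v (g * (φ v x)⁻¹) - κ v g)) (by
      intro x y
      apply Equiv.ext
      rintro ⟨g, m⟩
      simp only [PP, Equiv.Perm.mul_apply, Equiv.coe_fn_mk, Prod.mk.injEq, map_mul, mul_inv_rev,
        mul_assoc, true_and]
      ring))
    (fun e => PP (t e) (fun g => f e g + κ (ends e).2 (g * (t e)⁻¹) - κ (ends e).1 g))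
    (by
      intro e x
      rw [mul_inv_eq_iff_eq_mul]
      have hr := h.rel e x
      rw [mul_inv_eq_iff_eq_mul] at hr
      have hr' : ∀ g : Γ, g * (φ _ (ini e x))⁻¹ * (t e)⁻¹ = g * (t e)⁻¹ * (φ _ (ter e x))⁻¹ := by
        intro g
        rw [mul_assoc, mul_assoc, ← mul_inv_rev, ← mul_inv_rev, hr]
      apply Equiv.ext
      rintro ⟨g, m⟩
      simp only [PP, MonoidHom.mk'_apply, Equiv.Perm.mul_apply, Equiv.coe_fn_mk, Prod.mk.injEq]
      refine ⟨hr' g, ?_⟩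
      rw [hf, hr']
      ring)
    (by
      intro e he
      apply Equiv.ext
      rintro ⟨g, m⟩
      simp only [PP, Equiv.coe_fn_mk, Equiv.Perm.coe_one, id, h.tT e he, inv_one, mul_one,
        ← hκ e he g, Prod.mk.injEq, true_and]
      ring)
  have hform : ∀ γ, ∃ b, Ψ γ = PP γ b := by
    intro γ
    have hγ : γ ∈ Subgroup.closure ((⋃ v, Set.range (φ v)) ∪ Set.range t) := by rw [h.gen]; trivial
    induction hγ using Subgroup.closure_induction with
    | mem x hx =>
      rcases hx with hx | ⟨e, rfl⟩
      · obtain ⟨v, y, rfl⟩ := Set.mem_iUnion.1 hx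
        exact ⟨fun g => κ v (g * (φ v y)⁻¹) - κ v g, hΨ v y⟩
      · exact ⟨_, hΨt e⟩
    | one => exact ⟨0, by rw [map_one]; ext p <;> simp [PP]⟩
    | mul x y _ _ hx hy =>
      obtain ⟨b, hb⟩ := hx
      obtain ⟨b', hb'⟩ := hy
      refine ⟨fun g => b' g + b (g * y⁻¹), ?_⟩
      rw [map_mul, hb, hb']
      ext p <;> simp [PP, mul_assoc, add_assoc]
    | inv x _ hx =>
      obtain ⟨b, hb⟩ := hx
      refine ⟨fun g => - b (g * x), ?_⟩
      rw [map_inv, hb, inv_eq_iff_mul_eq_one]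
      apply Equiv.ext
      rintro ⟨g, m⟩
      simp only [PP, Equiv.Perm.mul_apply, Equiv.coe_fn_mk, Equiv.Perm.coe_one, id, Prod.mk.injEq,
        inv_inv, mul_inv_cancel_right, true_and]
      ring
  let pr : Γ → ZMod 2 := fun g => (Ψ g⁻¹ (1, 0)).2
  have hpr : ∀ g, Ψ g⁻¹ (1, 0) = (g, pr g) := by
    intro g
    obtain ⟨b, hb⟩ := hform g⁻¹
    refine Prod.ext ?_ rfl
    rw [hb]; simp [PP]
  have hpr2 : ∀ g γ, (g * γ⁻¹, pr (g * γ⁻¹)) = Ψ γ (g, pr g) := by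
    intro g γ
    rw [← hpr, ← hpr, ← Equiv.Perm.mul_apply, ← map_mul]
    congr 2
    group
  have hpt : ∀ e g, pr (g * (t e)⁻¹) - κ (ends e).2 (g * (t e)⁻¹) =
      pr g - κ (ends e).1 g + f e g := by
    intro e g
    have := congrArg Prod.snd (hpr2 g (t e))
    rw [hΨt] at this
    simp only [PP, Equiv.coe_fn_mk] at this
    rw [this]; ring
  refine ⟨fun g v => pr g - κ v g, ?_, ?_, ?_⟩
  · intro g v x
    have := congrArg Prod.snd (hpr2 g (φ v x⁻¹))
    rw [hΨ] at this
    have e1 : (φ v x⁻¹)⁻¹ = φ v x := by simp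
    simp only [PP, MonoidHom.mk'_apply, Equiv.coe_fn_mk, e1] at this
    simp only [this]; ring
  · intro e g hc
    simp only [hpt, f, if_pos hc]
  · intro e g hc
    simp only [hpt, f, if_neg hc, add_zero]

end BS
end AsdimGG
namespace AsdimGG

lemma tree_par {V : Type} {TG : SimpleGraph V} (hT : TG.IsTree) (r : V) :
    ∃ par : V → V, (∀ u, TG.dist (par u) r = TG.dist u r - 1) ∧
      ∀ a b, TG.Adj a b → a = par b ∨ b = par a := by
  classical
  have hc := hT.connected
  have h1 : ∀ u, ∃ w, TG.dist w r = TG.dist u r - 1 ∧ (u ≠ r → TG.Adj u w) := by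
    intro u
    by_cases hu : u = r
    · subst hu; exact ⟨u, by simp, by simp⟩
    obtain ⟨w, hw⟩ := (hc.preconnected u r).exists_walk_length_eq_dist
    cases w with
    | nil => exact (hu rfl).elim
    | @cons _ v _ h p =>
      refine ⟨v, ?_, fun _ => h⟩
      have a1 := SimpleGraph.dist_le p
      have a2 := hc.dist_triangle (u := u) (v := v) (w := r)
      have a3 : TG.dist u v = 1 := SimpleGraph.dist_eq_one_iff_adj.2 h
      simp only [SimpleGraph.Walk.length_cons] at hw
      omega
  choose par hp1 hp2 using h1
  have huniq : ∀ a b c, TG.Adj a b → TG.Adj a c → TG.dist b r + 1 = TG.dist a r →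
      TG.dist c r + 1 = TG.dist a r → b = c := by
    intro a b c hab hac hb hc'
    obtain ⟨w, hw⟩ := (hc.preconnected b r).exists_walk_length_eq_dist
    obtain ⟨w', hw'⟩ := (hc.preconnected c r).exists_walk_length_eq_dist
    have p1 := SimpleGraph.Walk.isPath_of_length_eq_dist (SimpleGraph.Walk.cons hab w)
      (by simp only [SimpleGraph.Walk.length_cons]; omega)
    have p2 := SimpleGraph.Walk.isPath_of_length_eq_dist (SimpleGraph.Walk.cons hac w')
      (by simp only [SimpleGraph.Walk.length_cons]; omega)
    have := (hT.isAcyclic.subsingleton_path a r).elim ⟨_, p1⟩ ⟨_, p2⟩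
    have := congrArg (fun p : TG.Path a r => p.1.snd) this
    simpa using this
  have key : ∀ a b, TG.Adj a b → TG.dist b r < TG.dist a r → b = par a := by
    intro a b hab hlt
    have a2 := hc.dist_triangle (u := a) (v := b) (w := r)
    have a3 : TG.dist a b = 1 := SimpleGraph.dist_eq_one_iff_adj.2 hab
    have hne : a ≠ r := by
      rintro rfl
      simp at hlt
    refine huniq a b (par a) hab (hp2 a hne) (by omega) ?_
    have := hp1 a
    omega
  refine ⟨par, hp1, fun a b hab => ?_⟩
  rcases lt_trichotomy (TG.dist a r) (TG.dist b r) with h | h | h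
  · exact Or.inl (key b a hab.symm h)
  · exfalso
    have := hT.dist_ne_of_adj r hab
    rw [SimpleGraph.dist_comm, h, SimpleGraph.dist_comm] at this
    exact this rfl
  · exact Or.inr (key a b hab h)

/-- the tree of spaces attached to a map of graphs -/
lemma exists_TSp {X V : Type} {GX : SimpleGraph X} (hX : GX.Connected) {TG : SimpleGraph V}
    (hT : TG.IsTree) (r : V) (π : X → V)
    (hπ : ∀ x y, GX.Adj x y → π x = π y ∨ TG.Adj (π x) (π y)) :
    ∃ S : TSp X V, S.d = GX.dist ∧ S.π = π ∧ (∀ u, 0 < S.δ u → u ≠ S.par u) ∧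
      ∀ u, S.C u = {x | π x = u ∧ ∃ y, GX.Adj x y ∧ π y = S.par u} := by
  obtain ⟨par, hp1, hp2⟩ := tree_par hT r
  refine ⟨{ d := GX.dist, pm := ⟨by simp, fun x y => SimpleGraph.dist_comm, fun x y z => hX.dist_triangle⟩,
            π := π, par := par, δ := fun u => TG.dist u r, δ_par := hp1, 
            δ_root := ?_, C := fun u => {x | π x = u ∧ ∃ y, GX.Adj x y ∧ π y = par u}, 
            C_π := fun u z hz => hz.1, C_par := ?_, gate := ?_, lip := ?_ }, rfl, rfl, ?_, fun _ => rfl⟩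
  · intro u w hu hw
    rw [(hT.connected.preconnected u r).dist_eq_zero_iff] at hu
    rw [(hT.connected.preconnected w r).dist_eq_zero_iff] at hw
    rw [hu, hw]
  · rintro u _ z ⟨-, y, hy, hy2⟩
    exact ⟨y, hy2, (SimpleGraph.dist_eq_one_iff_adj.2 hy).le⟩
  · intro u hu x y hx hy
    obtain ⟨w, hw⟩ := (hX.preconnected x y).exists_walk_length_eq_dist
    rw [← hw]
    clear hw
    induction w with
    | nil => exact (hy hx).elim
    | @cons x x' y h p ih =>
      by_cases hx' : Anc par u (π x')
      · obtain ⟨z, hz, hz2⟩ := ih hx' hy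
        refine ⟨z, hz, ?_⟩
        have a2 := hX.dist_triangle (u := x) (v := x') (w := z)
        have a3 : GX.dist x x' = 1 := SimpleGraph.dist_eq_one_iff_adj.2 h
        simp only [SimpleGraph.Walk.length_cons]
        omega
      · rcases hπ _ _ h with h1 | h1
        · rw [← h1] at hx'; exact (hx' hx).elim
        rcases hp2 _ _ h1 with h2 | h2
        · exfalso
          obtain ⟨k, hk⟩ := hx
          apply hx'
          exact ⟨k + 1, by rw [Function.iterate_succ_apply, ← h2, hk]⟩
        · obtain ⟨k, hk⟩ := hx
          cases k with
          | zero => 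
            simp only [Function.iterate_zero, id] at hk
            exact ⟨x, ⟨hk, x', h, by rw [h2, hk]⟩, by simp⟩
          | succ k => 
            exfalso; apply hx'
            exact ⟨k, by rw [h2, ← Function.iterate_succ_apply, hk]⟩
  · intro x y
    obtain ⟨w, hw⟩ := (hX.preconnected x y).exists_walk_length_eq_dist
    rw [← hw]
    clear hw
    induction w with
    | nil => simp
    | @cons x x' y h p ih =>
      simp only [SimpleGraph.Walk.length_cons]
      have : TG.dist (π x) r ≤ TG.dist (π x') r + 1 := by
        rcases hπ _ _ h with h1 | h1
        · rw [h1]; omega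
        · have a2 := hT.connected.dist_triangle (u := π x) (v := π x') (w := r)
          have a3 : TG.dist (π x) (π x') = 1 := SimpleGraph.dist_eq_one_iff_adj.2 h1
          omega
      omega
  · intro u hu he
    have := hp1 u
    simp only at hu he
    rw [← he] at this
    omega

end AsdimGG
namespace AsdimGG

lemma Col.mono {X : Type} {d : X → X → ℕ} {k : ℕ} {Y : Set X} {R B B' : ℕ} (h : Col d k Y R B)
    (hB : B ≤ B') : Col d k Y R B' := by
  obtain ⟨c, l, h1, h2, h3⟩ := h
  exact ⟨c, l, h1, h2, fun x hx y hy a b => (h3 x hx y hy a b).trans hB⟩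

lemma coset_col {Γ ι K : Type} [Group Γ] [Group K] (d : Γ × ι → Γ × ι → ℕ)
    (hinv : ∀ (γ a b : Γ) (v w : ι), d (γ * a, v) (γ * b, w) = d (a, v) (b, w))
    (hfin : ∀ x R, {y | d x y ≤ R}.Finite) {k : ℕ} (hK : ColG K k) (f : K →* Γ)
    (hf : Function.Injective f) (v : ι) (R : ℕ) :
    ∃ B, ∀ g0 : Γ, Col d k {p | p.2 = v ∧ ∃ x, p.1 = g0 * f x} R B := by
  classical
  have hF : {a : K | d (1, v) (f a, v) ≤ R}.Finite := by
    refine Set.Finite.preimage (f := fun a : K => ((f a, v) : Γ × ι)) ?_ (hfin (1, v) R)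
    intro a _ b _ hab
    exact hf (Prod.mk.inj hab).1
  obtain ⟨Bs, hBs, c, l, h1, h2, h3⟩ := hK _ hF
  obtain ⟨B, hB⟩ := (hBs.image (fun a => d (1, v) (f a, v))).bddAbove
  refine ⟨B, fun g0 => ?_⟩
  have hξ : ∀ p : Γ × ι, ∃ x : K, (∃ x, p.1 = g0 * f x) → p.1 = g0 * f x := by
    intro p
    by_cases h : ∃ x, p.1 = g0 * f x
    · obtain ⟨x, hx⟩ := h
      exact ⟨x, fun _ => hx⟩
    · exact ⟨1, fun h' => (h h').elim⟩
  choose ξ hξ using hξ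
  have hd : ∀ p ∈ {p : Γ × ι | p.2 = v ∧ ∃ x, p.1 = g0 * f x},
      ∀ q ∈ {p : Γ × ι | p.2 = v ∧ ∃ x, p.1 = g0 * f x},
      d p q = d (1, v) (f ((ξ p)⁻¹ * ξ q), v) := by
    rintro ⟨p, v1⟩ hp ⟨q, v2⟩ hq
    have e1 : v1 = v := hp.1
    have e2 : v2 = v1 := hq.1.trans e1.symm
    subst e1
    subst e2
    have a1 := hξ _ hp.2
    have a2 := hξ _ hq.2
    have b1 : f (ξ (p, v2)) = g0⁻¹ * p := eq_inv_mul_iff_mul_eq.2 (Eq.symm a1)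
    have b2 : f (ξ (q, v2)) = g0⁻¹ * q := eq_inv_mul_iff_mul_eq.2 (Eq.symm a2)
    have e : f ((ξ (p, v2))⁻¹ * ξ (q, v2)) = p⁻¹ * q := by
      rw [map_mul, map_inv, b1, b2]; group
    rw [e, ← hinv p 1, mul_one, mul_inv_cancel_left]
  refine Col.of_label (fun p => c (ξ p)) (fun p => l (ξ p)) (fun x _ => h1 _) ?_ ?_
  · intro p hp q hq hpq
    rw [hd p hp q hq] at hpq
    exact h2 _ _ hpq
  · intro p hp q hq hc hl
    rw [hd p hp q hq]
    exact hB ⟨_, h3 _ _ hc hl, rfl⟩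

section BS
variable {ι ε : Type} [Finite ι] [Finite ε] {ends : ε → ι × ι}
    {Gv : ι → Type} [∀ i, Group (Gv i)] {Ge : ε → Type} [∀ e, Group (Ge e)]
    {ini : ∀ e, Ge e →* Gv (ends e).1} {ter : ∀ e, Ge e →* Gv (ends e).2} {T : Set ε}
    {Γ : Type} [Group Γ] {φ : ∀ v, Gv v →* Γ} {t : ε → Γ}

def nodeS (φ : ∀ v, Gv v →* Γ) : Setoid (Γ × ι) where
  r p q := ∃ v x, p.2 = v ∧ q.2 = v ∧ q.1 = p.1 * φ v x
  iseqv := by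
    refine ⟨fun p => ⟨p.2, 1, rfl, rfl, by simp⟩, ?_, ?_⟩
    · rintro p q ⟨v, x, h1, h2, h3⟩
      exact ⟨v, x⁻¹, h2, h1, by rw [h3]; simp⟩
    · rintro p q r ⟨v, x, h1, h2, h3⟩ ⟨v', x', h1', h2', h3'⟩
      obtain rfl : v = v' := by rw [← h2, h1']
      exact ⟨v, x * x', h1, h2', by rw [h3', h3, map_mul, mul_assoc]⟩

def BSV (φ : ∀ v, Gv v →* Γ) : Type := Quotient (nodeS φ)

def nd (φ : ∀ v, Gv v →* Γ) (p : Γ × ι) : BSV φ := Quotient.mk (nodeS φ) p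

lemma nd_eq {p q : Γ × ι} : nd φ p = nd φ q ↔ ∃ v x, p.2 = v ∧ q.2 = v ∧ q.1 = p.1 * φ v x :=
  Quotient.eq (r := nodeS φ)

lemma nd_mul (g : Γ) (v : ι) (x : Gv v) : nd φ (g * φ v x, v) = nd φ (g, v) :=
  (nd_eq.2 ⟨v, x, rfl, rfl, rfl⟩).symm

variable (ends t φ) in
def TR (u w : BSV φ) : Prop :=
  ∃ e g, u = nd φ (g, (ends e).1) ∧ w = nd φ (g * (t e)⁻¹, (ends e).2)

variable (ends t φ) in
def TG : SimpleGraph (BSV φ) := SimpleGraph.fromRel (TR ends φ t)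

variable (ends t φ) in
def XR (Sv : ∀ v, Set (Gv v)) (p q : Γ × ι) : Prop :=
  (∃ v, ∃ s ∈ Sv v, p.2 = v ∧ q.2 = v ∧ q.1 = p.1 * φ v s) ∨
    (∃ e, p.2 = (ends e).1 ∧ q = (p.1 * (t e)⁻¹, (ends e).2))

variable (ends t φ) in
def GX (Sv : ∀ v, Set (Gv v)) : SimpleGraph (Γ × ι) := SimpleGraph.fromRel (XR ends φ t Sv)

lemma XR_cases {Sv : ∀ v, Set (Gv v)} {p q : Γ × ι} (h : XR ends φ t Sv p q) :
    nd φ p = nd φ q ∨ ∃ e g, p = (g, (ends e).1) ∧ q = (g * (t e)⁻¹, (ends e).2) := by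
  rcases h with ⟨v, s, _, h1, h2, h3⟩ | ⟨e, h1, h2⟩
  · exact Or.inl (nd_eq.2 ⟨v, s, h1, h2, h3⟩)
  · exact Or.inr ⟨e, p.1, Prod.ext rfl h1, h2⟩

lemma GX_TG {Sv : ∀ v, Set (Gv v)} (p q : Γ × ι) (h : (GX ends φ t Sv).Adj p q) :
    nd φ p = nd φ q ∨ (TG ends φ t).Adj (nd φ p) (nd φ q) := by
  by_cases hne : nd φ p = nd φ q
  · exact Or.inl hne
  right
  rw [GX, SimpleGraph.fromRel_adj] at h
  rw [TG, SimpleGraph.fromRel_adj]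
  refine ⟨hne, ?_⟩
  rcases h.2 with h | h
  · rcases XR_cases h with h | ⟨e, g, h1, h2⟩
    · exact (hne h).elim
    · exact Or.inl ⟨e, g, by rw [h1], by rw [h2]⟩
  · rcases XR_cases h with h | ⟨e, g, h1, h2⟩
    · exact (hne h.symm).elim
    · exact Or.inr ⟨e, g, by rw [h1], by rw [h2]⟩

lemma IsPi1.cross (h : IsPi1 ends Gv Ge ini ter T Γ φ t) (e : ε) (x : Ge e) (g : Γ) :
    g * φ _ (ini e x) * (t e)⁻¹ = g * (t e)⁻¹ * φ _ (ter e x) := by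
  rw [← h.rel]; group

lemma XR_reach {Sv : ∀ v, Set (Gv v)} {p q : Γ × ι} (h : XR ends φ t Sv p q) :
    (GX ends φ t Sv).Reachable p q := by
  by_cases hne : p = q
  · rw [hne]
  · exact SimpleGraph.Adj.reachable ((SimpleGraph.fromRel_adj _ _ _).2 ⟨hne, Or.inl h⟩)

lemma GX_conn (h : IsPi1 ends Gv Ge ini ter T Γ φ t)
    (hconn : ∀ a b : ι,
      Relation.ReflTransGen (fun a b : ι => ∃ e ∈ T, ends e = (a, b) ∨ ends e = (b, a)) a b)
    (v0 : ι) {Sv : ∀ v, Set (Gv v)} (hSv : ∀ v, Subgroup.closure (Sv v) = ⊤) :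
    (GX ends φ t Sv).Connected := by
  have s0 : ∀ e g, (GX ends φ t Sv).Reachable (g, (ends e).1) (g * (t e)⁻¹, (ends e).2) :=
    fun e g => XR_reach (Or.inr ⟨e, rfl, rfl⟩)
  have s1 : ∀ v (x : Gv v) g, (GX ends φ t Sv).Reachable (g, v) (g * φ v x, v) := by
    intro v x
    have hx : x ∈ Subgroup.closure (Sv v) := by rw [hSv]; trivial
    induction hx using Subgroup.closure_induction with
    | mem x hx => exact fun g => XR_reach (Or.inl ⟨v, x, hx, rfl, rfl, rfl⟩)
    | one => intro g; simp
    | mul x y _ _ hx hy =>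
      intro g
      rw [map_mul, ← mul_assoc]
      exact (hx g).trans (hy _)
    | inv x _ hx =>
      intro g
      have := (hx (g * φ v x⁻¹)).symm
      simpa using this
  have s2 : ∀ g v w, (GX ends φ t Sv).Reachable (g, v) (g, w) := by
    intro g v w
    induction hconn v w with
    | refl => exact SimpleGraph.Reachable.refl _
    | @tail b c _ hbc ih =>
      refine ih.trans ?_
      obtain ⟨e, he, hh⟩ := hbc
      have := s0 e g
      rw [h.tT e he, inv_one, mul_one] at this
      rcases hh with hh | hh
      · rw [hh] at this; exact this
      · rw [hh] at this; exact this.symm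
  have s3 : ∀ γ g, (GX ends φ t Sv).Reachable (g, v0) (g * γ, v0) := by
    intro γ
    have hγ : γ ∈ Subgroup.closure ((⋃ v, Set.range (φ v)) ∪ Set.range t) := by rw [h.gen]; trivial
    induction hγ using Subgroup.closure_induction with
    | mem x hx =>
      intro g
      rcases hx with hx | ⟨e, rfl⟩
      · obtain ⟨v, y, rfl⟩ := Set.mem_iUnion.1 hx
        exact ((s2 g v0 v).trans (s1 v y g)).trans (s2 _ v v0)
      · have := s0 e (g * t e)
        rw [mul_inv_cancel_right] at this
        exact ((s2 g v0 _).trans this.symm).trans (s2 _ _ v0)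
    | one => intro g; simp
    | mul x y _ _ hx hy =>
      intro g
      rw [← mul_assoc]
      exact (hx g).trans (hy _)
    | inv x _ hx =>
      intro g
      have := (hx (g * x⁻¹)).symm
      simpa using this
  have s4 : ∀ p, (GX ends φ t Sv).Reachable (1, v0) p := by
    rintro ⟨g, v⟩
    have := s3 g 1
    rw [one_mul] at this
    exact this.trans (s2 g v0 v)
  exact (SimpleGraph.connected_iff _).2 ⟨fun p q => (s4 p).symm.trans (s4 q), ⟨(1, v0)⟩⟩

lemma TG_conn {Sv : ∀ v, Set (Gv v)} (hX : (GX ends φ t Sv).Connected) :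
    (TG ends φ t).Connected := by
  have : ∀ p q, (GX ends φ t Sv).Walk p q → (TG ends φ t).Reachable (nd φ p) (nd φ q) := by
    intro p q w
    induction w with
    | nil => exact SimpleGraph.Reachable.refl _
    | cons h _ ih =>
      refine SimpleGraph.Reachable.trans ?_ ih
      rcases GX_TG _ _ h with h | h
      · rw [h]
      · exact h.reachable
  refine (SimpleGraph.connected_iff _).2 ⟨?_, ?_⟩
  · intro a b
    obtain ⟨p, rfl⟩ := Quotient.exists_rep a
    obtain ⟨q, rfl⟩ := Quotient.exists_rep b
    exact this p q (hX.preconnected p q).some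
  · obtain ⟨p⟩ := hX.nonempty
    exact ⟨nd φ p⟩

lemma IsPi1.qfun (h : IsPi1 ends Gv Ge ini ter T Γ φ t)
    (hconn : ∀ a b : ι,
      Relation.ReflTransGen (fun a b : ι => ∃ e ∈ T, ends e = (a, b) ∨ ends e = (b, a)) a b)
    (htree : Nat.card T + 1 = Nat.card ι) (e0 : ε) (g0 : Γ) :
    ∃ q : BSV φ → ZMod 2, 
      (∀ e g, (e = e0 ∧ ∃ x, g = g0 * φ _ (ini e x)) →
        q (nd φ (g * (t e)⁻¹, (ends e).2)) = q (nd φ (g, (ends e).1)) + 1) ∧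
      (∀ e g, ¬ (e = e0 ∧ ∃ x, g = g0 * φ _ (ini e x)) →
        q (nd φ (g * (t e)⁻¹, (ends e).2)) = q (nd φ (g, (ends e).1))) := by
  obtain ⟨Q, h1, h2, h3⟩ := h.cocycle hconn htree e0 g0
  refine ⟨Quotient.lift (fun p : Γ × ι => Q p.1 p.2) ?_, h2, h3⟩
  rintro p q ⟨v, x, a1, a2, a3⟩
  simp only [a1, a2, a3, h1]

lemma TG_tree (h : IsPi1 ends Gv Ge ini ter T Γ φ t)
    (hconn : ∀ a b : ι,
      Relation.ReflTransGen (fun a b : ι => ∃ e ∈ T, ends e = (a, b) ∨ ends e = (b, a)) a b)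
    (htree : Nat.card T + 1 = Nat.card ι) (hc : (TG ends φ t).Connected) :
    (TG ends φ t).IsTree := by
  refine ⟨hc, ?_⟩
  have key : ∀ u w, TR ends φ t u w → (TG ends φ t).IsBridge s(u, w) := by
    rintro u w ⟨e0, g0, rfl, rfl⟩
    rw [SimpleGraph.isBridge_iff]
    rintro ⟨p⟩
    obtain ⟨q, q1, q2⟩ := h.qfun hconn htree e0 g0
    have hstep : ∀ a b, TR ends φ t a b →
        s(a, b) ≠ s(nd φ (g0, (ends e0).1), nd φ (g0 * (t e0)⁻¹, (ends e0).2)) → q a = q b := by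
      rintro a b ⟨e, g, rfl, rfl⟩ hne
      by_cases hcond : e = e0 ∧ ∃ x, g = g0 * φ _ (ini e x)
      · exfalso; apply hne
        obtain ⟨rfl, x, rfl⟩ := hcond
        rw [h.cross, nd_mul, nd_mul]
      · exact (q2 e g hcond).symm
    have hw : ∀ a b, ((TG ends φ t).deleteEdges
        {s(nd φ (g0, (ends e0).1), nd φ (g0 * (t e0)⁻¹, (ends e0).2))}).Walk a b → q a = q b := by
      intro a b w
      induction w with
      | nil => rfl
      | cons hadj _ ih =>
        rw [← ih]
        rw [SimpleGraph.deleteEdges_adj, TG, SimpleGraph.fromRel_adj] at hadj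
        obtain ⟨⟨-, h1⟩, h2⟩ := hadj
        rw [Set.mem_singleton_iff] at h2
        rcases h1 with h1 | h1
        · exact hstep _ _ h1 h2
        · refine (hstep _ _ h1 ?_).symm
          rw [Sym2.eq_swap]; exact h2
    have e1 := hw _ _ p
    rw [q1 e0 g0 ⟨rfl, 1, by simp⟩] at e1
    simp at e1
  rw [SimpleGraph.isAcyclic_iff_forall_adj_isBridge]
  intro u w huw
  rw [TG, SimpleGraph.fromRel_adj] at huw
  rcases huw.2 with h' | h'
  · exact key _ _ h'
  · rw [Sym2.eq_swap]; exact key _ _ h'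

lemma gate_coset (h : IsPi1 ends Gv Ge ini ter T Γ φ t)
    (hconn : ∀ a b : ι,
      Relation.ReflTransGen (fun a b : ι => ∃ e ∈ T, ends e = (a, b) ∨ ends e = (b, a)) a b)
    (htree : Nat.card T + 1 = Nat.card ι) {Sv : ∀ v, Set (Gv v)} (u p : BSV φ) (hup : u ≠ p) :
    (∃ e g1, {x | nd φ x = u ∧ ∃ y, (GX ends φ t Sv).Adj x y ∧ nd φ y = p} ⊆
      {x | x.2 = (ends e).1 ∧ ∃ a, x.1 = g1 * ((φ _).comp (ini e)) a}) ∨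
    (∃ e g1, {x | nd φ x = u ∧ ∃ y, (GX ends φ t Sv).Adj x y ∧ nd φ y = p} ⊆
      {x | x.2 = (ends e).2 ∧ ∃ a, x.1 = g1 * ((φ _).comp (ter e)) a}) ∨
    {x | nd φ x = u ∧ ∃ y, (GX ends φ t Sv).Adj x y ∧ nd φ y = p} = ∅ := by
  have hadj : ∀ x y, (GX ends φ t Sv).Adj x y → nd φ x = u → nd φ y = p →
      (∃ e g, x = (g, (ends e).1) ∧ y = (g * (t e)⁻¹, (ends e).2)) ∨
      (∃ e g, y = (g, (ends e).1) ∧ x = (g * (t e)⁻¹, (ends e).2)) := by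
    intro x y hxy hx hy
    rw [GX, SimpleGraph.fromRel_adj] at hxy
    rcases hxy.2 with h1 | h1
    · rcases XR_cases h1 with h2 | h2
      · rw [hx, hy] at h2; exact (hup h2).elim
      · exact Or.inl h2
    · rcases XR_cases h1 with h2 | h2
      · rw [hx, hy] at h2; exact (hup h2.symm).elim
      · exact Or.inr h2
  by_cases hem : {x | nd φ x = u ∧ ∃ y, (GX ends φ t Sv).Adj x y ∧ nd φ y = p} = ∅
  · exact Or.inr (Or.inr hem)
  obtain ⟨x0, hx0, y0, hxy0, hy0⟩ := Set.nonempty_iff_ne_empty.2 hem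
  rcases hadj _ _ hxy0 hx0 hy0 with ⟨e0, g0, rfl, rfl⟩ | ⟨e0, g0, rfl, rfl⟩
  · left
    obtain ⟨q, q1, q2⟩ := h.qfun hconn htree e0 g0
    have hq : q p = q u + 1 := by
      rw [← hx0, ← hy0]; exact q1 e0 g0 ⟨rfl, 1, by simp⟩
    have hne : q p ≠ q u := by rw [hq]; simp
    refine ⟨e0, g0, ?_⟩
    rintro x ⟨hx, y, hxy, hy⟩
    rcases hadj _ _ hxy hx hy with ⟨e, g, rfl, rfl⟩ | ⟨e, g, rfl, rfl⟩
    · by_cases hcond : e = e0 ∧ ∃ x, g = g0 * φ _ (ini e x)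
      · obtain ⟨rfl, x, rfl⟩ := hcond
        exact ⟨rfl, x, rfl⟩
      · have := q2 e g hcond
        rw [hx, hy] at this
        exact (hne this).elim
    · exfalso
      by_cases hcond : e = e0 ∧ ∃ x, g = g0 * φ _ (ini e x)
      · obtain ⟨rfl, x, rfl⟩ := hcond
        rw [nd_mul] at hy
        exact hup (hx0.symm.trans hy)
      · have := q2 e g hcond
        rw [hx, hy] at this
        exact (hne this.symm).elim
  · right; left
    obtain ⟨q, q1, q2⟩ := h.qfun hconn htree e0 g0
    have hq : q u = q p + 1 := by
      rw [← hx0, ← hy0]; exact q1 e0 g0 ⟨rfl, 1, by simp⟩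
    have hne : q u ≠ q p := by rw [hq]; simp
    refine ⟨e0, g0 * (t e0)⁻¹, ?_⟩
    rintro x ⟨hx, y, hxy, hy⟩
    rcases hadj _ _ hxy hx hy with ⟨e, g, rfl, rfl⟩ | ⟨e, g, rfl, rfl⟩
    · exfalso
      by_cases hcond : e = e0 ∧ ∃ x, g = g0 * φ _ (ini e x)
      · obtain ⟨rfl, x, rfl⟩ := hcond
        rw [nd_mul] at hx
        exact hup (hx.symm.trans hy0)
      · have := q2 e g hcond
        rw [hx, hy] at this
        exact (hne this.symm).elim
    · by_cases hcond : e = e0 ∧ ∃ x, g = g0 * φ _ (ini e x)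
      · obtain ⟨rfl, x, rfl⟩ := hcond
        exact ⟨rfl, x, h.cross e x g0⟩
      · have := q2 e g hcond
        rw [hx, hy] at this
        exact (hne this).elim

lemma GX_inv {Sv : ∀ v, Set (Gv v)} (hX : (GX ends φ t Sv).Connected)
    (γ a b : Γ) (v w : ι) : (GX ends φ t Sv).dist (γ * a, v) (γ * b, w) =
      (GX ends φ t Sv).dist (a, v) (b, w) := by
  have hR : ∀ γ p q, XR ends φ t Sv p q → XR ends φ t Sv (γ * p.1, p.2) (γ * q.1, q.2) := by
    rintro γ p q (⟨v, s, hs, h1, h2, h3⟩ | ⟨e, h1, h2⟩)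
    · exact Or.inl ⟨v, s, hs, h1, h2, by simp only [h3, mul_assoc]⟩
    · exact Or.inr ⟨e, h1, by simp only [h2, mul_assoc]⟩
  have hle : ∀ (γ : Γ) p q, (GX ends φ t Sv).dist (γ * p.1, p.2) (γ * q.1, q.2) ≤
      (GX ends φ t Sv).dist p q := by
    intro γ p q
    obtain ⟨w, hw⟩ := (hX.preconnected p q).exists_walk_length_eq_dist
    let f : (GX ends φ t Sv) →g (GX ends φ t Sv) :=
      { toFun := fun p => (γ * p.1, p.2)
        map_rel' := by
          intro p q hpq
          rw [GX, SimpleGraph.fromRel_adj] at hpq ⊢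
          refine ⟨fun he => hpq.1 ?_, hpq.2.imp (hR γ _ _) (hR γ _ _)⟩
          rw [Prod.mk.injEq] at he
          exact Prod.ext (mul_left_cancel he.1) he.2 }
    rw [← hw, ← SimpleGraph.Walk.length_map f w]
    exact SimpleGraph.dist_le _
  refine le_antisymm (hle γ (a, v) (b, w)) ?_
  have := hle γ⁻¹ (γ * a, v) (γ * b, w)
  simpa using this

lemma GX_fin {Sv : ∀ v, Set (Gv v)} (hS : ∀ v, (Sv v).Finite) (hX : (GX ends φ t Sv).Connected)
    (x : Γ × ι) (R : ℕ) : {y | (GX ends φ t Sv).dist x y ≤ R}.Finite := by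
  have hN : ∀ x, {y | (GX ends φ t Sv).Adj x y}.Finite := by
    intro x
    have h1 : (⋃ v, (fun s => ((x.1 * φ v s, v) : Γ × ι)) '' Sv v).Finite :=
      Set.finite_iUnion fun v => (hS v).image _
    have h2 : (⋃ v, (fun s => ((x.1 * (φ v s)⁻¹, v) : Γ × ι)) '' Sv v).Finite :=
      Set.finite_iUnion fun v => (hS v).image _
    have h3 : (Set.range fun e => ((x.1 * (t e)⁻¹, (ends e).2) : Γ × ι)).Finite :=
      Set.finite_range _
    have h4 : (Set.range fun e => ((x.1 * t e, (ends e).1) : Γ × ι)).Finite :=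
      Set.finite_range _
    refine ((h1.union h2).union (h3.union h4)).subset ?_
    rintro ⟨g, w⟩ hy
    rw [Set.mem_ofPred_eq, GX, SimpleGraph.fromRel_adj] at hy
    rcases hy.2 with (⟨v, s, hs, a1, a2, a3⟩ | ⟨e, a1, a2⟩) | (⟨v, s, hs, a1, a2, a3⟩ | ⟨e, a1, a2⟩)
    · left; left
      simp only at a1 a2 a3
      subst a2
      exact Set.mem_iUnion.2 ⟨_, s, hs, by rw [a3]⟩
    · right; left
      exact ⟨e, a2.symm⟩
    · left; right
      simp only at a1 a2 a3
      subst a1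
      exact Set.mem_iUnion.2 ⟨_, s, hs, by rw [a3]; simp⟩
    · right; right
      simp only at a1
      subst a1
      exact ⟨e, by rw [a2]; simp⟩
  induction R with
  | zero =>
    refine (Set.finite_singleton x).subset fun y hy => ?_
    rw [Set.mem_ofPred_eq, Nat.le_zero, (hX.preconnected x y).dist_eq_zero_iff] at hy
    exact hy.symm
  | succ R ih =>
    refine (ih.union (ih.biUnion fun z _ => hN z)).subset fun y hy => ?_
    rcases Nat.lt_or_ge R ((GX ends φ t Sv).dist x y) with hlt | hge
    swap
    · exact Or.inl hge
    right
    rw [Set.mem_ofPred_eq, SimpleGraph.dist_comm] at hy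
    rw [SimpleGraph.dist_comm] at hlt
    obtain ⟨w, hw⟩ := (hX.preconnected y x).exists_walk_length_eq_dist
    cases w with
    | nil => simp at hlt
    | @cons _ z _ hadj p =>
      refine Set.mem_biUnion (x := z) ?_ hadj.symm
      have := SimpleGraph.dist_le p
      rw [Set.mem_ofPred_eq, SimpleGraph.dist_comm]
      simp only [SimpleGraph.Walk.length_cons] at hw
      omega

set_option maxHeartbeats 1000000 in
theorem IsPi1.asdimLE [∀ i, Group.FG (Gv i)] (h : IsPi1 ends Gv Ge ini ter T Γ φ t)
    (hini : ∀ e, Function.Injective (ini e)) (hter : ∀ e, Function.Injective (ter e))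
    (hconn : ∀ a b : ι,
      Relation.ReflTransGen (fun a b : ι => ∃ e ∈ T, ends e = (a, b) ∨ ends e = (b, a)) a b)
    (htree : Nat.card T + 1 = Nat.card ι) (n : ℕ) (hv : ∀ v, ColG (Gv v) (n + 1))
    (he : ∀ e, ColG (Ge e) n) : AsdimLE Γ n := by
  classical
  have hcount : ∀ i, Countable (Gv i) := fun i => fg_countable _
  have hφ := h.inj hini hter hconn htree
  have hne : Nonempty ι := by
    by_contra h
    rw [not_nonempty_iff] at h
    have h0 : Nat.card ι = 0 := Nat.card_of_isEmpty
    omega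
  obtain ⟨v0⟩ := hne
  have hfg : ∀ v, ∃ S : Finset (Gv v), Subgroup.closure (S : Set (Gv v)) = ⊤ := fun v =>
    Group.fg_def.1 inferInstance
  choose Sv0 hSv0 using hfg
  obtain ⟨Sv, hSf, hSg⟩ : ∃ Sv : ∀ v, Set (Gv v), (∀ v, (Sv v).Finite) ∧
      ∀ v, Subgroup.closure (Sv v) = ⊤ := ⟨fun v => Sv0 v, fun v => (Sv0 v).finite_toSet, hSv0⟩
  have hX := GX_conn h hconn v0 hSg
  have hT := TG_tree h hconn htree (TG_conn hX)
  obtain ⟨TS, hd, hπ, hpar, hC⟩ := exists_TSp hX hT (nd φ (1, v0)) (nd φ) GX_TG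
  have hinv : ∀ (γ a b : Γ) (v w : ι), TS.d (γ * a, v) (γ * b, w) = TS.d (a, v) (b, w) := by
    rw [hd]; exact GX_inv hX
  have hfin : ∀ x R, {y | TS.d x y ≤ R}.Finite := by
    rw [hd]; exact GX_fin hSf hX
  have hnode : ∀ R, ∃ B, ∀ u, Col TS.d (n + 1) {x | TS.π x = u} R B := by
    intro R
    choose B hB using fun v => coset_col TS.d hinv hfin (hv v) (φ v) (hφ v) v R
    obtain ⟨M, hM⟩ := (Set.finite_range B).bddAbove
    refine ⟨M, fun u => ?_⟩
    obtain ⟨⟨g, v⟩, rfl⟩ := Quotient.exists_rep u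
    refine ((hB v g).mono (hM ⟨v, rfl⟩)).subset ?_
    intro x hx
    rw [hπ] at hx
    have hx' : nd φ (g, v) = nd φ x := Eq.symm hx
    obtain ⟨w, y, a1, a2, a3⟩ := nd_eq.1 hx'
    simp only at a1
    subst a1
    exact ⟨a2, y, a3⟩
  have hgate : ∀ R, ∃ B, ∀ u, 0 < TS.δ u → Col TS.d n (TS.C u) R B := by
    intro R
    choose B1 hB1 using fun e => coset_col TS.d hinv hfin (he e) ((φ _).comp (ini e))
      ((hφ _).comp (hini e)) (ends e).1 R
    choose B2 hB2 using fun e => coset_col TS.d hinv hfin (he e) ((φ _).comp (ter e))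
      ((hφ _).comp (hter e)) (ends e).2 R
    obtain ⟨M1, hM1⟩ := (Set.finite_range B1).bddAbove
    obtain ⟨M2, hM2⟩ := (Set.finite_range B2).bddAbove
    refine ⟨max M1 M2, fun u hu => ?_⟩
    rw [hC]
    rcases gate_coset h hconn htree (Sv := Sv) u (TS.par u) (hpar u hu) with
      ⟨e, g, hs⟩ | ⟨e, g, hs⟩ | hs
    · exact ((hB1 e g).mono ((hM1 ⟨e, rfl⟩).trans (le_max_left _ _))).subset hs
    · exact ((hB2 e g).mono ((hM2 ⟨e, rfl⟩).trans (le_max_right _ _))).subset hs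
    · rw [hs]
      exact ⟨fun _ => 0, id, by simp, by simp, by simp⟩
  intro S hS R
  obtain ⟨RX, hRX⟩ := ((wb_finite S.finite_toSet R (1 : Γ)).image
    (fun a => TS.d (1, v0) (a, v0))).bddAbove
  have hdd : ∀ a b : Γ, TS.d (a, v0) (b, v0) = TS.d (1, v0) (a⁻¹ * b, v0) := by
    intro a b
    rw [← hinv a 1]; simp
  have hR : ∀ g k, k ∈ wordBall (S : Set Γ) R g → TS.d (g, v0) (k, v0) ≤ RX := by
    intro g k hk
    rw [hdd]
    exact hRX ⟨_, wb_iff.1 hk, rfl⟩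
  obtain ⟨B, J, Φ, hΦ, hcode⟩ := TS.main n hnode hgate RX
  refine ⟨{U | ∃ j, U = {g | Φ (g, v0) = j}}, ?_, ?_, ?_⟩
  · refine Set.eq_univ_of_forall fun g => ⟨{k | Φ (k, v0) = Φ (g, v0)}, ⟨_, rfl⟩, rfl⟩
  · have hF : {a : Γ | TS.d (1, v0) (a, v0) ≤ B}.Finite := by
      refine Set.Finite.preimage (f := fun a : Γ => ((a, v0) : Γ × ι)) ?_ (hfin (1, v0) B)
      intro a _ b _ hab
      exact (Prod.mk.inj hab).1
    obtain ⟨R', hR'⟩ := wb_exh_fin hS hF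
    refine ⟨R', ?_⟩
    rintro U ⟨j, rfl⟩ x hx y hy
    rw [wb_iff]
    apply hR'
    have := hΦ (x, v0) (y, v0) (Eq.trans hx (Eq.symm hy))
    rw [hdd] at this
    exact this
  · intro g
    obtain ⟨code, hc1, hc2⟩ := hcode (g, v0)
    let H := {U ∈ {U | ∃ j, U = {g | Φ (g, v0) = j}} | (wordBall (S : Set Γ) R g ∩ U).Nonempty}
    have hy : ∀ U : H, ∃ y, y ∈ wordBall (S : Set Γ) R g ∧ U.1 = {k | Φ (k, v0) = Φ (y, v0)} := by
      rintro ⟨U, ⟨j, rfl⟩, y, hy1, hy2⟩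
      refine ⟨y, hy1, ?_⟩
      have : Φ (y, v0) = j := hy2
      rw [this]
    choose y hy1 hy2 using hy
    let f : H → Fin (n + 1) := fun U => ⟨code (y U, v0), hc1 _ (hR _ _ (hy1 U))⟩
    have hf : Function.Injective f := by
      intro U U' hUU
      have := hc2 _ _ (hR _ _ (hy1 U)) (hR _ _ (hy1 U')) (Fin.mk.inj hUU)
      apply Subtype.ext
      rw [hy2 U, hy2 U', this]
    have hfi : Finite H := Finite.of_injective f hf
    refine ⟨Set.toFinite H, ?_⟩
    have := Nat.card_le_card_of_injective f hf
    rw [Nat.card_fin] at this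
    exact this

end BS
end AsdimGG
namespace AsdimGG

lemma asdim_le {G : Type} [Group G] {n : ℕ} (h : AsdimLE G n) : asdim G ≤ n :=
  sInf_le ⟨n, h, rfl⟩

lemma exists_of_asdim_le {G : Type} [Group G] {n : ℕ} (h : asdim G ≤ n) : ∃ k ≤ n, AsdimLE G k := by
  have hne : ((↑) '' {n : ℕ | AsdimLE G n} : Set ℕ∞).Nonempty := by
    by_contra hc
    rw [Set.not_nonempty_iff_eq_empty] at hc
    rw [asdim, hc, sInf_empty] at h
    simp at h
  obtain ⟨k, hk, hk2⟩ := csInf_mem hne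
  refine ⟨k, ?_, hk⟩
  have h' : sInf ((↑) '' {n : ℕ | AsdimLE G n} : Set ℕ∞) ≤ n := h
  rw [← hk2] at h'
  exact_mod_cast h'

end AsdimGG

/-- The asymptotic dimension of the fundamental group of a finite graph of finitely
generated groups is at most the maximum over vertices `v` and edges `e` of
`asdim G_v` and `asdim G_e + 1`.  The fundamental group is presented, via a choice of
spanning tree `T`, as the quotient of the free product of the vertex groups with the
free group on the edges by the Bass--Serre relations. -/
theorem asdim_graph_of_groups {ι ε : Type} [Fintype ι] [Fintype ε]
    (ends : ε → ι × ι)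
    (Gv : ι → Type) [∀ i, Group (Gv i)] [∀ i, Group.FG (Gv i)]
    (Ge : ε → Type) [∀ e, Group (Ge e)] [∀ e, Group.FG (Ge e)]
    (ini : ∀ e, Ge e →* Gv (ends e).1) (ter : ∀ e, Ge e →* Gv (ends e).2)
    (hini : ∀ e, Function.Injective (ini e)) (hter : ∀ e, Function.Injective (ter e))
    (T : Set ε)
    -- `T` spans: every two vertices are joined by a path of edges of `T`
    (hconn : ∀ a b : ι,
      Relation.ReflTransGen (fun a b : ι => ∃ e ∈ T, ends e = (a, b) ∨ ends e = (b, a)) a b)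
    -- `T` is a tree: it has one fewer edge than there are vertices
    (htree : Nat.card T + 1 = Nat.card ι) :
    asdim ((Monoid.Coprod (Monoid.CoprodI Gv) (FreeGroup ε)) ⧸ Subgroup.normalClosure
        ({x | ∃ e : ε, ∃ g : Ge e,
            x = Monoid.Coprod.inr (FreeGroup.of e)
              * Monoid.Coprod.inl (Monoid.CoprodI.of (ini e g))
              * (Monoid.Coprod.inr (FreeGroup.of e))⁻¹
              * (Monoid.Coprod.inl (Monoid.CoprodI.of (ter e g)))⁻¹}
          ∪ {x | ∃ e ∈ T, x = Monoid.Coprod.inr (FreeGroup.of e)}))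
      ≤ (⨆ v, asdim (Gv v)) ⊔ (⨆ e, asdim (Ge e) + 1) := by
  set N := Subgroup.normalClosure
        ({x : Monoid.Coprod (Monoid.CoprodI Gv) (FreeGroup ε) | ∃ e : ε, ∃ g : Ge e,
            x = Monoid.Coprod.inr (FreeGroup.of e)
              * Monoid.Coprod.inl (Monoid.CoprodI.of (ini e g))
              * (Monoid.Coprod.inr (FreeGroup.of e))⁻¹
              * (Monoid.Coprod.inl (Monoid.CoprodI.of (ter e g)))⁻¹}
          ∪ {x | ∃ e ∈ T, x = Monoid.Coprod.inr (FreeGroup.of e)}) with hN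
  rcases eq_or_ne ((⨆ v, asdim (Gv v)) ⊔ (⨆ e, asdim (Ge e) + 1)) ⊤ with htop | htop
  · rw [htop]; exact le_top
  obtain ⟨n, hn⟩ := ENat.ne_top_iff_exists.1 htop
  rw [← hn]
  have hv : ∀ v, AsdimGG.ColG (Gv v) (n + 1) := by
    intro v
    have : asdim (Gv v) ≤ n := by
      rw [hn]; exact (le_iSup (fun v => asdim (Gv v)) v).trans le_sup_left
    obtain ⟨k, hk, hk2⟩ := AsdimGG.exists_of_asdim_le this
    exact (AsdimGG.colG_of_asdimLE hk2).mono (by omega)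
  have he : ∀ e, AsdimGG.ColG (Ge e) n := by
    intro e
    have h1 : asdim (Ge e) + 1 ≤ n := by
      rw [hn]; exact (le_iSup (fun e => asdim (Ge e) + 1) e).trans le_sup_right
    cases n with
    | zero => simp at h1
    | succ m =>
      have : asdim (Ge e) ≤ m := by
        rw [Nat.cast_succ] at h1
        exact (ENat.add_le_add_iff_right ENat.one_ne_top).1 h1
      obtain ⟨k, hk, hk2⟩ := AsdimGG.exists_of_asdim_le this
      exact (AsdimGG.colG_of_asdimLE hk2).mono (by omega)
  apply AsdimGG.asdim_le
  have hpi : AsdimGG.IsPi1 ends Gv Ge ini ter T _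
      (fun v => (QuotientGroup.mk' N).comp (Monoid.Coprod.inl.comp Monoid.CoprodI.of))
      (fun e => QuotientGroup.mk' N (Monoid.Coprod.inr (FreeGroup.of e))) := by
    refine ⟨?_, ?_, ?_, ?_⟩
    · intro e x
      rw [← mul_inv_eq_one]
      simp only [MonoidHom.comp_apply]
      have hm : Monoid.Coprod.inr (FreeGroup.of e)
              * Monoid.Coprod.inl (Monoid.CoprodI.of (ini e x))
              * (Monoid.Coprod.inr (FreeGroup.of e))⁻¹
              * (Monoid.Coprod.inl (Monoid.CoprodI.of (ter e x)))⁻¹ ∈ N :=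
        Subgroup.subset_normalClosure (Or.inl ⟨e, x, rfl⟩)
      exact (QuotientGroup.eq_one_iff _).2 hm
    · intro e he
      rw [QuotientGroup.mk'_apply, QuotientGroup.eq_one_iff]
      exact Subgroup.subset_normalClosure (Or.inr ⟨e, he, rfl⟩)
    · rw [eq_top_iff]
      intro y _
      obtain ⟨z, rfl⟩ := QuotientGroup.mk'_surjective N y
      clear * -
      induction z using Monoid.Coprod.induction_on with
      | inl a =>
        induction a using Monoid.CoprodI.induction_on with
        | one => simp
        | of i m => 
          apply Subgroup.subset_closure
          exact Or.inl (Set.mem_iUnion.2 ⟨i, m, rfl⟩)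
        | mul x y hx hy =>
          rw [map_mul, map_mul]
          exact mul_mem hx hy
      | inr a =>
        induction a using FreeGroup.induction_on with
        | C1 => simp
        | of x =>
          apply Subgroup.subset_closure
          exact Or.inr ⟨x, rfl⟩
        | inv_of x hx =>
          rw [map_inv, map_inv]
          exact inv_mem hx
        | mul x y hx hy =>
          rw [map_mul, map_mul]
          exact mul_mem hx hy
      | mul x y hx hy =>
        rw [map_mul]
        exact mul_mem (hx) (hy)
    · intro H _ ψ s h1 h2
      have hle : N ≤ (Monoid.Coprod.lift (Monoid.CoprodI.lift ψ) (FreeGroup.lift s)).ker := by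
        apply Subgroup.normalClosure_le_normal
        rintro x (⟨e, g, rfl⟩ | ⟨e, he, rfl⟩)
        · simp [MonoidHom.mem_ker, h1]
        · simp [MonoidHom.mem_ker, h2 e he]
      refine ⟨QuotientGroup.lift N _ hle, ?_, ?_⟩
      · intro v x
        simp
      · intro e
        simp
  exact hpi.asdimLE hini hter hconn htree n hv he
end

section
/- Let Γ be a finite simplicial labeled graph that is a single edge [a,b] with label m ≥ 2. Then the Artin group A_Γ = ⟨a, b | (ab)^… = (ba)^… (alternating words of length m)⟩ has asymptotic dimension exactly 2. -/
/-- The alternating product `xyxy⋯` of length `m`. -/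
def braidProd {M : Type*} [Monoid M] (m : ℕ) (x y : M) : M :=
  ((List.range m).map (fun i => if i % 2 = 0 then x else y)).prod

/-- The alternating word `abab⋯` of length `m` in the free group. -/
def braidWord {V : Type*} (m : ℕ) (a b : V) : FreeGroup V :=
  braidProd m (FreeGroup.of a) (FreeGroup.of b)

section Aux
open scoped Pointwise

theorem wb_finite {G : Type*} [Group G] (S : Set G) (hS : S.Finite) (R : ℕ) :
    (wordBall S R 1).Finite := by
  induction R with
  | zero =>
    apply (Set.finite_singleton (1 : G)).subset
    rintro h ⟨w, hw, -, rfl⟩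
    have : w = [] := by simpa using hw
    simp [this]
  | succ R ih =>
    have hS' : (S ∪ S⁻¹).Finite := hS.union hS.inv
    apply ((Set.finite_singleton (1 : G)).union (hS'.mul ih)).subset
    rintro h ⟨w, hw, hm, rfl⟩
    cases w with
    | nil => left; simp
    | cons a w =>
      right
      refine ⟨a, ?_, w.prod, ⟨w, by simpa using hw, fun x hx => hm x (by simp [hx]), by simp⟩, by simp⟩
      have := hm a (by simp)
      simpa using this

theorem wb_iff {G : Type*} [Group G] (S : Set G) (R : ℕ) (g h : G) :
    h ∈ wordBall S R g ↔ g⁻¹ * h ∈ wordBall S R 1 := by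
  constructor
  · rintro ⟨w, h1, h2, rfl⟩
    exact ⟨w, h1, h2, by simp⟩
  · rintro ⟨w, h1, h2, h3⟩
    refine ⟨w, h1, h2, ?_⟩
    rw [one_mul] at h3
    rw [← h3]; simp

theorem wb_absorb {G : Type*} [Group G] (S : Set G) (hS : Subgroup.closure S = ⊤)
    (F : Set G) (hF : F.Finite) : ∃ B, F ⊆ wordBall S B 1 := by
  have h : ∀ g : G, ∃ l : List G, (∀ y ∈ l, y ∈ S ∨ y⁻¹ ∈ S) ∧ l.prod = g := by
    intro g
    have hg : g ∈ (Subgroup.closure S).toSubmonoid := by rw [hS]; trivial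
    rw [Subgroup.closure_toSubmonoid] at hg
    obtain ⟨l, h1, h2⟩ := Submonoid.exists_list_of_mem_closure hg
    exact ⟨l, fun y hy => by simpa using h1 y hy, h2⟩
  choose l h1 h2 using h
  obtain ⟨B, hB⟩ := (hF.image (fun g => (l g).length)).bddAbove
  refine ⟨B, fun g hg => ⟨l g, hB ⟨g, hg, rfl⟩, h1 g, by simp [h2]⟩⟩

def TreeLike (Q : Type*) [Group Q] : Prop :=
  ∃ (T : Set Q) (nf : Q → List Q), T.Finite ∧ nf 1 = [] ∧ (∀ x, ∀ a ∈ nf x, a ∈ T) ∧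
    (∀ x, (nf x).prod = x) ∧
    ∀ q, ∃ R : ℕ, ∀ x, ∃ s s' p, nf x = s ++ p ∧ nf (q * x) = s' ++ p ∧
      s.length ≤ R ∧ s'.length ≤ R

def T3 (Q : Type*) [Group Q] : Prop :=
  ∀ K : Set Q, K.Finite → ∃ F : Set Q, F.Finite ∧
    ∃ (A : Fin 3 → Set Q) (p : Fin 3 → Q → ℕ × List Q),
      (∀ x i i', i ≠ i' → x ∈ A i ∨ x ∈ A i') ∧
      (∀ i x k, k ∈ K → x ∈ A i → x * k ∈ A i → p i x = p i (x * k)) ∧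
      (∀ i x y, x ∈ A i → y ∈ A i → p i x = p i y → x⁻¹ * y ∈ F)

theorem arith1 (L h i i' : ℕ) (hL : 0 < L) (hi : i < 3) (hi' : i' < 3) (hne : i ≠ i')
    (h1 : 2 * L ≤ (h + (2 - i) * L) % (3 * L)) (h2 : 2 * L ≤ (h + (2 - i') * L) % (3 * L)) :
    False := by
  wlog hlt : i < i' generalizing i i'
  · exact this i' i hi' hi hne.symm h2 h1 (by omega)
  have a1 := Nat.mod_lt (h + (2 - i) * L) (show 0 < 3 * L by omega)
  have a2 := Nat.mod_lt (h + (2 - i') * L) (show 0 < 3 * L by omega)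
  have b1 := Nat.div_add_mod (h + (2 - i) * L) (3 * L)
  have b2 := Nat.div_add_mod (h + (2 - i') * L) (3 * L)
  generalize (h + (2 - i) * L) % (3 * L) = r at *
  generalize (h + (2 - i') * L) % (3 * L) = r' at *
  generalize (h + (2 - i) * L) / (3 * L) = a at *
  generalize (h + (2 - i') * L) / (3 * L) = a' at *
  have key : a = a' ∨ 3 * L * a' + 3 * L ≤ 3 * L * a ∨ 3 * L * a + 3 * L ≤ 3 * L * a' := by
    rcases lt_trichotomy a a' with h | h | h
    · right; right
      have := Nat.mul_le_mul_left (3 * L) (Nat.succ_le_of_lt h)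
      rw [Nat.mul_succ] at this; exact this
    · left; exact h
    · right; left
      have := Nat.mul_le_mul_left (3 * L) (Nat.succ_le_of_lt h)
      rw [Nat.mul_succ] at this; exact this
  have : (i = 0 ∧ i' = 1) ∨ (i = 0 ∧ i' = 2) ∨ (i = 1 ∧ i' = 2) := by omega
  rcases this with ⟨rfl, rfl⟩ | ⟨rfl, rfl⟩ | ⟨rfl, rfl⟩ <;> rcases key with rfl | key | key <;> omega

theorem arith2 (L R x y : ℕ) (hL : R < L) (h1 : x % (3 * L) < 2 * L) (h2 : y % (3 * L) < 2 * L)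
    (h3 : x ≤ y + R) (h4 : y ≤ x + R) : x / (3 * L) = y / (3 * L) := by
  have b1 := Nat.div_add_mod x (3 * L)
  have b2 := Nat.div_add_mod y (3 * L)
  generalize x % (3 * L) = r at *
  generalize y % (3 * L) = r' at *
  generalize x / (3 * L) = a at *
  generalize y / (3 * L) = a' at *
  rcases lt_trichotomy a a' with h | h | h
  · have := Nat.mul_le_mul_left (3 * L) (Nat.succ_le_of_lt h)
    rw [Nat.mul_succ] at this; omega
  · exact h
  · have := Nat.mul_le_mul_left (3 * L) (Nat.succ_le_of_lt h)
    rw [Nat.mul_succ] at this; omega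

theorem drop_eq {α : Type*} (s s' p : List α) (b : ℕ) (hb : b ≤ p.length) :
    (s ++ p).drop ((s ++ p).length - b) = (s' ++ p).drop ((s' ++ p).length - b) := by
  have e : ∀ t : List α, (t ++ p).drop ((t ++ p).length - b) = p.drop (p.length - b) := by
    intro t
    rw [List.length_append, Nat.add_sub_assoc hb, ← List.drop_drop, List.drop_left]
  rw [e, e]

theorem TreeLike.t3 {Q : Type*} [Group Q] (hQ : TreeLike Q) : T3 Q := by
  obtain ⟨T, nf, hT, -, hnfT, hprod, hR⟩ := hQ
  intro K hK
  choose Rf hRf using hR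
  obtain ⟨R, hRK⟩ := (hK.image (fun k => Rf k⁻¹)).bddAbove
  have hRK : ∀ k ∈ K, Rf k⁻¹ ≤ R := fun k hk => hRK ⟨k, hk, rfl⟩
  set L := R + 1 with hLdef
  let h : Q → ℕ := fun x => (nf x⁻¹).length
  let off : Fin 3 → ℕ := fun i => (2 - i.1) * L
  let hh : Fin 3 → Q → ℕ := fun i x => h x + off i
  let j : Fin 3 → Q → ℕ := fun i x => hh i x / (3 * L)
  let b : Fin 3 → ℕ → ℕ := fun i n => 3 * L * n - off i - R
  let W := wordBall T (2 * L + R) 1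
  have hW : W.Finite := wb_finite T hT _
  refine ⟨W * W⁻¹, hW.mul hW.inv, fun i => {x | hh i x % (3 * L) < 2 * L},
    fun i x => (j i x, (nf x⁻¹).drop (h x - b i (j i x))), ?_, ?_, ?_⟩
  · intro x i i' hne
    by_contra hcon
    simp only [Set.mem_ofPred_eq, not_or, not_lt] at hcon
    exact arith1 L (h x) i i' (by omega) i.2 i'.2 (fun e => hne (Fin.ext e)) hcon.1 hcon.2
  · intro i x k hk hx hy
    simp only [Set.mem_ofPred_eq] at hx hy
    obtain ⟨s, s', p, e1, e2, l1, l2⟩ := hRf k⁻¹ x⁻¹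
    rw [← mul_inv_rev] at e2
    have hr := hRK k hk
    have hx' : h x = s.length + p.length := by simp [h, e1]
    have hy' : h (x * k) = s'.length + p.length := by simp only [h, e2]; simp
    have hj : j i x = j i (x * k) := by
      apply arith2 L R _ _ (by omega) hx hy
      · simp only [hh]; omega
      · simp only [hh]; omega
    have hb : b i (j i x) ≤ p.length := by
      have := Nat.mul_div_le (hh i x) (3 * L)
      simp only [b, j, hh] at *
      omega
    refine Prod.ext hj ?_
    simp only [← hj]
    simp only [h, e1, e2]
    exact drop_eq _ _ _ _ hb
  · intro i x y hx hy hxy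
    simp only [Set.mem_ofPred_eq] at hx hy
    have hj : j i x = j i y := congrArg Prod.fst hxy
    have hd := congrArg Prod.snd hxy
    simp only at hd
    have key : ∀ z, hh i z % (3 * L) < 2 * L →
        ((nf z⁻¹).take (h z - b i (j i z))).prod ∈ W := by
      intro z hz
      refine ⟨(nf z⁻¹).take (h z - b i (j i z)), ?_,
        fun a ha => Or.inl (hnfT _ a (List.mem_of_mem_take ha)), (one_mul _).symm⟩
      rw [List.length_take]
      have := Nat.div_add_mod (hh i z) (3 * L)
      simp only [b, j, hh] at *
      omega
    have dec : ∀ z, z⁻¹ = ((nf z⁻¹).take (h z - b i (j i z))).prod *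
        ((nf z⁻¹).drop (h z - b i (j i z))).prod := by
      intro z
      rw [← List.prod_append, List.take_append_drop, hprod]
    refine ⟨_, key x hx, (((nf y⁻¹).take (h y - b i (j i y))).prod)⁻¹, ?_, ?_⟩
    · simpa using key y hy
    · have dx := dec x
      have dy := dec y
      rw [hd] at dx
      show _ * _ = _
      generalize ((nf y⁻¹).take (h y - b i (j i y))).prod = v at dy ⊢
      generalize ((nf x⁻¹).take (h x - b i (j i x))).prod = u at dx ⊢
      generalize ((nf y⁻¹).drop (h y - b i (j i y))).prod = w at dx dy
      have e : y = (v * w)⁻¹ := by rw [← dy, inv_inv]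
      rw [dx, e]
      group

theorem upper {G P Z : Type*} [Group G] [Group P] [Group Z] (φ : G →* P) (ψ : G →* Z)
    (hP : T3 P) (hZ : T3 Z) (inj : ∀ g, φ g = 1 → ψ g = 1 → g = 1) : AsdimLE G 2 := by
  intro S hS R
  have hB := wb_finite (S : Set G) S.finite_toSet R
  set Bl := wordBall (S : Set G) R 1 with hBl
  have hK := hB.inv.mul hB
  obtain ⟨F1, hF1, A1, p1, c1, d1, b1⟩ := hP _ (hK.image φ)
  obtain ⟨F2, hF2, A2, p2, c2, d2, b2⟩ := hZ _ (hK.image ψ)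
  have hF : {g | φ g ∈ F1 ∧ ψ g ∈ F2}.Finite := by
    have hi : Function.Injective (φ.prod ψ) := by
      rw [injective_iff_map_eq_one]
      intro g hg
      exact inj g (congrArg Prod.fst hg) (congrArg Prod.snd hg)
    exact ((hF1.prod hF2).preimage hi.injOn).subset (fun g hg => hg)
  obtain ⟨B, hBB⟩ := wb_absorb (S : Set G) hS _ hF
  let cl : Fin 3 → G → Set G := fun i y =>
    {g | φ g ∈ A1 i ∧ ψ g ∈ A2 i ∧ p1 i (φ g) = p1 i (φ y) ∧ p2 i (ψ g) = p2 i (ψ y)}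
  refine ⟨{U | ∃ i y, U = cl i y}, ?_, ⟨B, ?_⟩, ?_⟩
  · rw [Set.eq_univ_iff_forall]
    intro g
    have : ∃ i, φ g ∈ A1 i ∧ ψ g ∈ A2 i := by
      have x1 := c1 (φ g) 0 1 (by decide)
      have x2 := c1 (φ g) 0 2 (by decide)
      have x3 := c1 (φ g) 1 2 (by decide)
      have y1 := c2 (ψ g) 0 1 (by decide)
      have y2 := c2 (ψ g) 0 2 (by decide)
      have y3 := c2 (ψ g) 1 2 (by decide)
      by_contra hcon
      push Not at hcon
      have z0 := hcon 0
      have z1 := hcon 1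
      have z2 := hcon 2
      tauto
    obtain ⟨i, h1, h2⟩ := this
    exact ⟨cl i g, ⟨i, g, rfl⟩, h1, h2, rfl, rfl⟩
  · rintro U ⟨i, z, rfl⟩ x ⟨hx1, hx2, hx3, hx4⟩ y ⟨hy1, hy2, hy3, hy4⟩
    rw [wb_iff]
    apply hBB
    refine ⟨?_, ?_⟩
    · rw [map_mul, map_inv]; exact b1 i _ _ hx1 hy1 (hx3.trans hy3.symm)
    · rw [map_mul, map_inv]; exact b2 i _ _ hx2 hy2 (hx4.trans hy4.symm)
  · intro g
    classical
    let f : Fin 3 → Set G := fun i =>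
      if h : ∃ y ∈ wordBall (S : Set G) R g, φ y ∈ A1 i ∧ ψ y ∈ A2 i then cl i h.choose else ∅
    have hsub : {U ∈ {U | ∃ i y, U = cl i y} | (wordBall (S : Set G) R g ∩ U).Nonempty} ⊆
        Set.range f := by
      rintro U ⟨⟨i, z, rfl⟩, y, hy, hy1, hy2, hy3, hy4⟩
      have h : ∃ y ∈ wordBall (S : Set G) R g, φ y ∈ A1 i ∧ ψ y ∈ A2 i := ⟨y, hy, hy1, hy2⟩
      refine ⟨i, ?_⟩
      simp only [f, dif_pos h]
      obtain ⟨k1, k2, k3⟩ := h.choose_spec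
      set w := h.choose
      have hk : y⁻¹ * w ∈ Bl⁻¹ * Bl := by
        rw [wb_iff] at hy k1
        refine ⟨(g⁻¹ * y)⁻¹, by simpa using hy, g⁻¹ * w, k1, ?_⟩
        simp [mul_assoc]
      have e : w = y * (y⁻¹ * w) := by simp
      have q1 : p1 i (φ w) = p1 i (φ z) := by
        rw [← hy3]; symm
        have := d1 i (φ y) (φ (y⁻¹ * w)) ⟨_, hk, rfl⟩ hy1
        rw [← map_mul, ← e] at this
        exact this k2
      have q2 : p2 i (ψ w) = p2 i (ψ z) := by
        rw [← hy4]; symm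
        have := d2 i (ψ y) (ψ (y⁻¹ * w)) ⟨_, hk, rfl⟩ hy2
        rw [← map_mul, ← e] at this
        exact this k3
      simp only [cl, q1, q2]
    refine ⟨(Set.finite_range f).subset hsub, ?_⟩
    refine (Set.ncard_le_ncard hsub (Set.finite_range f)).trans ?_
    rw [← Set.image_univ]
    refine (Set.ncard_image_le Set.finite_univ).trans ?_
    simp [Set.ncard_univ]

def ee (a b : Fin 3) : ℤ := if a = b then 0 else if b = a + 1 then 1 else -1

theorem ee_tri : ∀ a b c : Fin 3, (a = b ∨ b = c ∨ a = c) → ee a b + ee b c = ee a c := by decide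

theorem ee_inc : ∀ a b : Fin 3, (a ≠ 2 ∧ b ≠ 2) ∨ (a ≠ 0 ∧ b ≠ 0) → ee a b = (b.1 : ℤ) - a.1 := by
  decide

theorem ee_dec : ∀ a b : Fin 3, (a ≠ 1 ∧ b ≠ 1) →
    ee a b = (if b = 2 then -1 else 0) - (if a = 2 then -1 else 0) := by
  decide

/-- discrete Sperner / winding number lemma -/
theorem sperner (N : ℕ) (c : ℕ → ℕ → Fin 3)
    (t1 : ∀ i j, c i j = c (i+1) j ∨ c (i+1) j = c (i+1) (j+1) ∨ c i j = c (i+1) (j+1))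
    (t2 : ∀ i j, c i j = c i (j+1) ∨ c i (j+1) = c (i+1) (j+1) ∨ c i j = c (i+1) (j+1))
    (left : ∀ j, c 0 j = 0) (bot : ∀ i, c i 0 ≠ 2) (right : ∀ j, c N j ≠ 0)
    (top : ∀ i, c i N ≠ 1) (htop : c N N = 2) : False := by
  let g : ℕ → ℕ → ℤ := fun i j => ∑ s ∈ Finset.range i, ee (c s 0) (c (s+1) 0) +
    ∑ t ∈ Finset.range j, ee (c i t) (c i (t+1))
  have gup : ∀ i j, g i (j+1) = g i j + ee (c i j) (c i (j+1)) := by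
    intro i j
    simp only [g, Finset.sum_range_succ]; ring
  have gright : ∀ j i, g (i+1) j = g i j + ee (c i j) (c (i+1) j) := by
    intro j
    induction j with
    | zero => intro i; simp only [g, Finset.sum_range_succ, Finset.sum_range_zero]; ring
    | succ j ih =>
      intro i
      rw [gup, gup, ih]
      have h1 := ee_tri _ _ _ (t1 i j)
      have h2 := ee_tri _ _ _ (t2 i j)
      linarith
  have g00 : g 0 0 = 0 := by simp [g]
  have gl : ∀ j, g 0 j = 0 := by
    intro j
    induction j with
    | zero => exact g00
    | succ j ih => rw [gup, ih, left, left]; simp [ee]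
  have gb : ∀ i, g i 0 = (c i 0).1 := by
    intro i
    induction i with
    | zero => rw [g00, left]; simp
    | succ i ih => rw [gright, ih, ee_inc _ _ (Or.inl ⟨bot _, bot _⟩)]; ring
  have gr : ∀ j, g N j = (c N j).1 := by
    intro j
    induction j with
    | zero => exact gb N
    | succ j ih => rw [gup, ih, ee_inc _ _ (Or.inr ⟨right _, right _⟩)]; ring
  have gt : ∀ i, g i N = if c i N = 2 then -1 else 0 := by
    intro i
    induction i with
    | zero => rw [gl, left]; simp
    | succ i ih => rw [gright, ih, ee_dec _ _ ⟨top _, top _⟩]; ring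
  have h1 := gr N
  have h2 := gt N
  rw [htop] at h1 h2
  rw [h1] at h2
  simp at h2

theorem two_of_three {α : Type*} (s : Set α) (hs : s.Finite) (hc : s.ncard ≤ 2) (x y z : α)
    (hx : x ∈ s) (hy : y ∈ s) (hz : z ∈ s) : x = y ∨ y = z ∨ x = z := by
  by_contra hcon
  push Not at hcon
  obtain ⟨h1, h2, h3⟩ := hcon
  have hsub : ({x, y, z} : Set α) ⊆ s := by
    rintro w (rfl | rfl | rfl) <;> assumption
  have h := Set.ncard_le_ncard hsub hs
  rw [Set.ncard_eq_three.2 ⟨x, y, z, h1, h3, h2, rfl⟩] at h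
  omega

theorem lower {G : Type*} [Group G] (S : Finset G) (hS : Subgroup.closure (S : Set G) = ⊤)
    (f : ℤ × ℤ → G) (hf : ∀ p q, f (p + q) = f p * f q) (hinj : Function.Injective f)
    (n : ℕ) (hn : n ≤ 1) : ¬ AsdimLE G n := by
  intro H
  have hsub : ∀ p q, (f p)⁻¹ * f q = f (q - p) := by
    intro p q
    rw [inv_mul_eq_iff_eq_mul, ← hf]; simp
  obtain ⟨R, hR⟩ := wb_absorb (S : Set G) hS (f '' {(0,0),(1,0),(0,1),(1,1)})
    ((Set.toFinite _).image f)
  obtain ⟨𝒰, hcov, ⟨B, hB⟩, hmul⟩ := H S hS R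
  have hfin : {p | f p ∈ wordBall (S : Set G) B 1}.Finite :=
    (wb_finite (S : Set G) S.finite_toSet B).preimage hinj.injOn
  obtain ⟨N1, hN1⟩ := (hfin.image (fun p => p.1.natAbs)).bddAbove
  obtain ⟨N2, hN2⟩ := (hfin.image (fun p => p.2.natAbs)).bddAbove
  have hdiff : ∀ U ∈ 𝒰, ∀ p q, f p ∈ U → f q ∈ U →
      (q.1 - p.1).natAbs ≤ N1 ∧ (q.2 - p.2).natAbs ≤ N2 := by
    intro U hU p q hp hq
    have h := hB U hU _ hp _ hq
    rw [wb_iff, hsub] at h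
    exact ⟨hN1 ⟨_, h, rfl⟩, hN2 ⟨_, h, rfl⟩⟩
  have hex : ∀ g : G, ∃ U ∈ 𝒰, g ∈ U := by
    intro g
    have : g ∈ ⋃₀ 𝒰 := by rw [hcov]; trivial
    exact this
  choose u hu1 hu2 using hex
  let pt : ℕ → ℕ → ℤ × ℤ := fun i j => (i, j)
  let v : ℕ → ℕ → Set G := fun i j => u (f (pt i j))
  have hv1 : ∀ i j, v i j ∈ 𝒰 := fun i j => hu1 _
  have hv2 : ∀ i j, f (pt i j) ∈ v i j := fun i j => hu2 _
  classical
  let col : Set G → Fin 3 := fun U =>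
    if ∃ p : ℤ × ℤ, f p ∈ U ∧ p.1 ≤ 0 then 0 else if ∃ p : ℤ × ℤ, f p ∈ U ∧ p.2 ≤ 0 then 1 else 2
  have hmem : ∀ i j a b, a ≤ 1 → b ≤ 1 → v (i+a) (j+b) ∈
      {U ∈ 𝒰 | (wordBall (S : Set G) R (f (pt i j)) ∩ U).Nonempty} := by
    intro i j a b ha hb
    refine ⟨hv1 _ _, f (pt (i+a) (j+b)), ?_, hv2 _ _⟩
    rw [wb_iff, hsub]
    apply hR
    refine ⟨_, ?_, rfl⟩
    interval_cases a <;> interval_cases b <;> simp [pt, Prod.ext_iff]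
  have hcard : ∀ g, {U ∈ 𝒰 | (wordBall (S : Set G) R g ∩ U).Nonempty}.ncard ≤ 2 := by
    intro g
    have := (hmul g).2
    exact this.trans (by omega)
  have hcongr : ∀ x y z : Set G, (x = y ∨ y = z ∨ x = z) →
      (col x = col y ∨ col y = col z ∨ col x = col z) := by
    rintro x y z (rfl | rfl | rfl) <;> simp
  have far : ∀ i j (p : ℤ × ℤ), f p ∈ v i j → (i : ℤ) - p.1 ≤ N1 ∧ (j : ℤ) - p.2 ≤ N2 := by
    intro i j p hp
    have := hdiff _ (hv1 i j) p (pt i j) hp (hv2 i j)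
    simp only [pt] at this
    omega
  set N := N1 + N2 + 1 with hN
  have no0 : ∀ j, ¬ ∃ p : ℤ × ℤ, f p ∈ v N j ∧ p.1 ≤ 0 := by
    rintro j ⟨p, hp, hp'⟩
    have := far _ _ _ hp
    omega
  have no1 : ∀ i, ¬ ∃ p : ℤ × ℤ, f p ∈ v i N ∧ p.2 ≤ 0 := by
    rintro j ⟨p, hp, hp'⟩
    have := far _ _ _ hp
    omega
  have yes0 : ∀ j, ∃ p : ℤ × ℤ, f p ∈ v 0 j ∧ p.1 ≤ 0 := fun j => ⟨_, hv2 0 j, by simp [pt]⟩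
  have yes1 : ∀ i, ∃ p : ℤ × ℤ, f p ∈ v i 0 ∧ p.2 ≤ 0 := fun i => ⟨_, hv2 i 0, by simp [pt]⟩
  refine sperner N (fun i j => col (v i j)) ?_ ?_ ?_ ?_ ?_ ?_ ?_
  · intro i j
    exact hcongr _ _ _ (two_of_three _ (hmul (f (pt i j))).1 (hcard _) _ _ _
      (hmem i j 0 0 (by simp) (by simp)) (hmem i j 1 0 (by simp) (by simp))
      (hmem i j 1 1 (by simp) (by simp)))
  · intro i j
    exact hcongr _ _ _ (two_of_three _ (hmul (f (pt i j))).1 (hcard _) _ _ _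
      (hmem i j 0 0 (by simp) (by simp)) (hmem i j 0 1 (by simp) (by simp))
      (hmem i j 1 1 (by simp) (by simp)))
  · intro j; simp only [col]; rw [if_pos (yes0 j)]
  · intro i; simp only [col]; rw [if_pos (yes1 i)]; split_ifs <;> decide
  · intro j; simp only [col]; rw [if_neg (no0 j)]; split_ifs <;> decide
  · intro i; simp only [col]; rw [if_neg (no1 i)]; split_ifs <;> decide
  · simp only [col]; rw [if_neg (no0 N), if_neg (no1 N)]

theorem treeLike_of_finite (Q : Type*) [Group Q] [Finite Q] : TreeLike Q := by
  classical
  refine ⟨Set.univ, fun g => if g = 1 then [] else [g], Set.finite_univ, by simp, by simp, ?_, ?_⟩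
  · intro x; dsimp only; split_ifs with h <;> simp [h]
  · intro q
    refine ⟨1, fun x => ⟨_, _, [], (List.append_nil _).symm, (List.append_nil _).symm, ?_, ?_⟩⟩ <;>
      dsimp only <;> split_ifs <;> simp

theorem close_trans {α : Type*} (l l' l'' : List α) (R1 R2 : ℕ)
    (h1 : ∃ s s' p, l = s ++ p ∧ l' = s' ++ p ∧ s.length ≤ R1 ∧ s'.length ≤ R1)
    (h2 : ∃ s s' p, l' = s ++ p ∧ l'' = s' ++ p ∧ s.length ≤ R2 ∧ s'.length ≤ R2) :
    ∃ s s' p, l = s ++ p ∧ l'' = s' ++ p ∧ s.length ≤ R1 + R2 ∧ s'.length ≤ R1 + R2 := by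
  obtain ⟨s, s', p, rfl, rfl, a1, a2⟩ := h1
  obtain ⟨t, t', q, e, rfl, b1, b2⟩ := h2
  rcases List.append_eq_append_iff.1 e with ⟨u, e1, e2⟩ | ⟨u, e1, e2⟩
  · refine ⟨s ++ u, t', q, by simp [e2], rfl, ?_, by omega⟩
    have := congrArg List.length e1
    simp at *
    omega
  · refine ⟨s, t' ++ u, p, rfl, by simp [e2], by omega, ?_⟩
    have := congrArg List.length e1
    simp at *
    omega

theorem treeLike_int : TreeLike (Multiplicative ℤ) := by
  let t : Multiplicative ℤ := Multiplicative.ofAdd 1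
  let nf : Multiplicative ℤ → List (Multiplicative ℤ) := fun x =>
    List.replicate x.toAdd.natAbs (if 0 ≤ x.toAdd then t else t⁻¹)
  have step : ∀ x, ∃ s s' p, nf x = s ++ p ∧ nf (t * x) = s' ++ p ∧ s.length ≤ 1 ∧ s'.length ≤ 1 := by
    intro x
    induction x using Multiplicative.rec with | _ n => ?_
    simp only [nf, t, toAdd_mul, toAdd_ofAdd]
    by_cases h : 0 ≤ n
    · refine ⟨[], [Multiplicative.ofAdd 1], _, rfl, ?_, by simp, by simp⟩
      rw [if_pos h, if_pos (by omega), show (1 + n).natAbs = n.natAbs + 1 by omega,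
        List.replicate_succ]; rfl
    · refine ⟨[(Multiplicative.ofAdd 1)⁻¹], [], _, ?_, rfl, by simp, by simp⟩
      rw [if_neg h, show n.natAbs = (1 + n).natAbs + 1 by omega, List.replicate_succ]
      by_cases h' : 0 ≤ 1 + n
      · have : n = -1 := by omega
        subst this; simp
      · rw [if_neg h']; rfl
  refine ⟨{t, t⁻¹}, nf, Set.toFinite _, by simp [nf], ?_, ?_, ?_⟩
  · intro x a ha
    have := List.eq_of_mem_replicate ha
    rw [this]; split_ifs <;> simp
  · intro x
    simp only [nf, List.prod_replicate]
    induction x using Multiplicative.rec with | _ n => ?_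
    simp only [toAdd_ofAdd, t]
    split_ifs with h
    · rw [← ofAdd_nsmul]; congr 1; simp; omega
    · rw [← ofAdd_neg, ← ofAdd_nsmul]; congr 1; rw [nsmul_eq_mul]; omega
  · intro q
    have pos : ∀ n : ℕ, ∀ x, ∃ s s' p, nf x = s ++ p ∧ nf (t ^ n * x) = s' ++ p ∧
        s.length ≤ n ∧ s'.length ≤ n := by
      intro n
      induction n with
      | zero => intro x; exact ⟨[], [], nf x, rfl, by simp, by simp, by simp⟩
      | succ n ih =>
        intro x
        have := close_trans _ _ _ _ _ (ih x) (step (t ^ n * x))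
        rwa [← mul_assoc, ← pow_succ'] at this
    have hq : q = t ^ q.toAdd := by
      induction q using Multiplicative.rec with | _ n => ?_
      simp only [t, toAdd_ofAdd, ← ofAdd_zsmul]; simp
    refine ⟨q.toAdd.natAbs, fun x => ?_⟩
    rcases Int.natAbs_eq q.toAdd with h | h
    · have := pos q.toAdd.natAbs x
      rwa [← zpow_natCast, ← h, ← hq] at this
    · obtain ⟨s, s', p, e1, e2, l1, l2⟩ := pos q.toAdd.natAbs (q * x)
      have e : t ^ q.toAdd.natAbs * (q * x) = x := by
        have : t ^ q.toAdd.natAbs * q = 1 := by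
          conv_lhs => rw [← zpow_natCast]; rhs; rw [hq, h]
          rw [← zpow_add]; simp
        rw [← mul_assoc, this, one_mul]
      rw [e] at e2
      exact ⟨s', s, p, e2, e1, l2, l1⟩

theorem treeLike_zmod (n : ℕ) : TreeLike (Multiplicative (ZMod n)) := by
  cases n with
  | zero => exact treeLike_int
  | succ n =>
    have : Finite (Multiplicative (ZMod (n+1))) := inferInstanceAs (Finite (Fin (n+1)))
    exact treeLike_of_finite _

open Monoid.CoprodI in
theorem treeLike_coprod {ι : Type*} [Finite ι] (M : ι → Type*) [∀ i, Group (M i)]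
    (h : ∀ i, TreeLike (M i)) : TreeLike (Monoid.CoprodI M) := by
  classical
  choose T nf hT hone hmem hprod hcl using h
  let W : Word M → List (Monoid.CoprodI M) := fun w =>
    w.toList.flatMap (fun a => (nf a.1 a.2).map (of : M a.1 →* Monoid.CoprodI M))
  have hWr : ∀ i (p : Word.Pair M i), W (Word.rcons p) =
      (nf i p.head).map (of : M i →* Monoid.CoprodI M) ++ W p.tail := by
    intro i p
    unfold Word.rcons
    split_ifs with h
    · rw [h, hone]; rfl
    · simp [W, Word.cons]
  have hWp : ∀ w : Word M, (W w).prod = w.prod := by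
    intro w
    simp only [W, Word.prod]
    generalize w.toList = l
    induction l with
    | nil => rfl
    | cons a l ih =>
      rw [List.flatMap_cons, List.prod_append, ih, List.map_cons, List.prod_cons,
        List.prod_hom, hprod]
  have hsm : ∀ (x y : Monoid.CoprodI M), Word.equiv (x * y) = x • Word.equiv y := by
    intro x y
    simp [Word.equiv, mul_smul]
  refine ⟨⋃ i, (of : M i →* Monoid.CoprodI M) '' T i, fun x => W (Word.equiv x), ?_, ?_, ?_, ?_, ?_⟩
  · exact Set.finite_iUnion (fun i => (hT i).image _)
  · simp [Word.equiv, W, Word.empty]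
  · intro x a ha
    simp only [W, List.mem_flatMap, List.mem_map] at ha
    obtain ⟨b, -, c, hc, rfl⟩ := ha
    exact Set.mem_iUnion.2 ⟨b.1, c, hmem _ _ _ hc, rfl⟩
  · intro x
    rw [hWp]
    exact Word.equiv.symm_apply_apply x
  · intro q
    induction q using Monoid.CoprodI.induction_on with
    | one => exact ⟨0, fun x => ⟨[], [], _, rfl, by rw [one_mul]; rfl, by simp, by simp⟩⟩
    | of i m =>
      obtain ⟨R, hR⟩ := hcl i m
      refine ⟨R, fun x => ?_⟩
      simp only [hsm]
      generalize Word.equiv x = w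
      obtain ⟨s, s', p, e1, e2, l1, l2⟩ := hR (Word.equivPair i w).head
      refine ⟨s.map of, s'.map of, p.map of ++ W (Word.equivPair i w).tail, ?_, ?_, by simpa, by simpa⟩
      · conv_lhs => rw [← (Word.equivPair i).symm_apply_apply w, Word.equivPair_symm, hWr, e1]
        simp
      · rw [Word.of_smul_def, hWr]
        simp only [e2]
        simp
    | mul x y hx hy =>
      obtain ⟨R1, h1⟩ := hx
      obtain ⟨R2, h2⟩ := hy
      refine ⟨R2 + R1, fun z => ?_⟩
      rw [mul_assoc]
      exact close_trans _ _ _ _ _ (h2 z) (h1 (y * z))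

theorem braidProd_even {M : Type*} [Monoid M] (k : ℕ) (x y : M) :
    braidProd (2 * k) x y = (x * y) ^ k := by
  induction k with
  | zero => simp [braidProd]
  | succ k ih =>
    unfold braidProd at *
    rw [show 2 * (k + 1) = 2 * k + 1 + 1 by ring, List.range_succ, List.range_succ]
    simp only [List.map_append, List.prod_append, ih, pow_succ]
    have : (2 * k + 1) % 2 = 1 := by omega
    simp [this, mul_assoc]

theorem braidProd_odd {M : Type*} [Monoid M] (k : ℕ) (x y : M) :
    braidProd (2 * k + 1) x y = (x * y) ^ k * x := by
  have := braidProd_even k x y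
  unfold braidProd at *
  rw [List.range_succ]
  simp [this]

theorem map_braidProd {M N : Type*} [Monoid M] [Monoid N] (f : M →* N) (m : ℕ) (x y : M) :
    f (braidProd m x y) = braidProd m (f x) (f y) := by
  unfold braidProd
  rw [map_list_prod, List.map_map]
  congr 2
  funext i
  simp only [Function.comp]
  split_ifs <;> rfl

abbrev Art (m : ℕ) := PresentedGroup
      ({braidWord m true false * (braidWord m false true)⁻¹} : Set (FreeGroup Bool))

def ga (m : ℕ) : Art m := PresentedGroup.of true
def gb (m : ℕ) : Art m := PresentedGroup.of false

theorem art_rel (m : ℕ) : braidProd m (ga m) (gb m) = braidProd m (gb m) (ga m) := by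
  have h : PresentedGroup.mk ({braidWord m true false * (braidWord m false true)⁻¹} :
      Set (FreeGroup Bool)) (braidWord m true false * (braidWord m false true)⁻¹) = 1 :=
    PresentedGroup.one_of_mem (Set.mem_singleton _)
  rw [map_mul, map_inv, mul_inv_eq_one] at h
  have e : ∀ c d : Bool, PresentedGroup.mk ({braidWord m true false * (braidWord m false true)⁻¹} :
      Set (FreeGroup Bool)) (braidWord m c d) = braidProd m (PresentedGroup.of c)
        (PresentedGroup.of d) := fun c d => map_braidProd _ _ _ _
  rw [e, e] at h
  exact h

theorem art_hom (m : ℕ) {H : Type*} [Group H] (x y : H) (h : braidProd m x y = braidProd m y x) :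
    ∃ f : Art m →* H, f (ga m) = x ∧ f (gb m) = y := by
  have hr : ∀ r ∈ ({braidWord m true false * (braidWord m false true)⁻¹} : Set (FreeGroup Bool)),
      FreeGroup.lift (fun b : Bool => if b then x else y) r = 1 := by
    rintro r rfl
    rw [map_mul, map_inv, mul_inv_eq_one]
    simpa only [braidWord, map_braidProd, FreeGroup.lift_apply_of, if_true, Bool.false_eq_true, if_false] using h
  refine ⟨PresentedGroup.toGroup hr, ?_, ?_⟩
  · simp [ga]
  · simp [gb]

theorem art_ext (m : ℕ) {H : Type*} [Group H] (f g : Art m →* H) (h1 : f (ga m) = g (ga m))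
    (h2 : f (gb m) = g (gb m)) : f = g := by
  apply PresentedGroup.ext
  intro x
  cases x
  · exact h2
  · exact h1

theorem art_gen (m : ℕ) : ∃ S : Finset (Art m), Subgroup.closure (S : Set (Art m)) = ⊤ := by
  classical
  refine ⟨Finset.univ.image (PresentedGroup.of : Bool → Art m), ?_⟩
  rw [Finset.coe_image, Finset.coe_univ, Set.image_univ]
  exact PresentedGroup.closure_range_of _

theorem art_central (m : ℕ) (z : Art m) (h1 : z * ga m = ga m * z) (h2 : z * gb m = gb m * z) :
    ∀ g, z * g = g * z := by
  have : ∀ g, g ∈ Subgroup.centralizer {z} := by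
    intro g
    apply PresentedGroup.generated_by
    intro j
    rw [Subgroup.mem_centralizer_singleton_iff]
    cases j
    · exact h2.symm
    · exact h1.symm
  intro g
  exact (Subgroup.mem_centralizer_singleton_iff.1 (this g)).symm

theorem asdim_eq_two {G P : Type*} [Group G] [Group P] (hP : TreeLike P) (S : Finset G)
    (hS : Subgroup.closure (S : Set G) = ⊤) (φ : G →* P) (l : G →* Multiplicative ℤ) (z t : G)
    (hz : ∀ g, φ g = 1 → ∃ j : ℤ, g = z ^ j) (hlz : (l z).toAdd ≠ 0) (hφz : φ z = 1)
    (ht : ∀ i : ℤ, φ t ^ i = 1 → i = 0) (hc : Commute z t) : asdim G = 2 := by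
  have hzj : ∀ j : ℤ, l (z ^ j) = 1 → j = 0 := by
    intro j hj
    have := congrArg Multiplicative.toAdd hj
    rw [map_zpow, toAdd_zpow, toAdd_one, smul_eq_mul] at this
    exact (mul_eq_zero.1 this).resolve_right hlz
  have hup : AsdimLE G 2 := by
    apply upper φ l hP.t3 treeLike_int.t3
    intro g h1 h2
    obtain ⟨j, rfl⟩ := hz g h1
    rw [hzj j h2, zpow_zero]
  have hlow : ∀ n ≤ 1, ¬ AsdimLE G n := by
    apply lower S hS (fun p => t ^ p.1 * z ^ p.2)
    · rintro ⟨i, j⟩ ⟨i', j'⟩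
      have : Commute (z ^ j) (t ^ i') := (hc.zpow_left j).zpow_right i'
      simp only [Prod.mk_add_mk, zpow_add]
      rw [mul_assoc, mul_assoc, ← mul_assoc (t ^ i'), ← this.eq, mul_assoc]
    · rintro ⟨i, j⟩ ⟨i', j'⟩ h
      simp only at h
      have h1 := congrArg φ h
      simp only [map_mul, map_zpow, hφz, one_zpow, mul_one] at h1
      have hi : i = i' := by
        have := ht (i - i') (by rw [zpow_sub, h1, mul_inv_cancel])
        omega
      subst hi
      have h2 := mul_left_cancel h
      have hj := hzj (j - j') (by rw [zpow_sub, h2, mul_inv_cancel, map_one])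
      have : j = j' := by omega
      rw [this]
  unfold asdim
  apply le_antisymm
  · exact sInf_le ⟨2, hup, rfl⟩
  · apply le_sInf
    rintro _ ⟨n, hn, rfl⟩
    have : 2 ≤ n := by
      by_contra hcon
      exact hlow n (by omega) hn
    exact_mod_cast this

theorem zmod_hom (n : ℕ) {H : Type*} [Group H] (x : H) (hx : x ^ n = 1) :
    ∃ f : Multiplicative (ZMod n) →* H, f (Multiplicative.ofAdd 1) = x := by
  refine ⟨AddMonoidHom.toMultiplicativeLeft (ZMod.lift n ⟨zmultiplesHom (Additive H) (Additive.ofMul x), ?_⟩), ?_⟩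
  · simp [← ofMul_pow, hx]
  · have := ZMod.lift_coe n (A := Additive H) ⟨zmultiplesHom (Additive H) (Additive.ofMul x), by simp [← ofMul_pow, hx]⟩ 1
    simp at this
    simp [this]

abbrev PP (n : Bool → ℕ) := Monoid.CoprodI (fun b => Multiplicative (ZMod (n b)))
def gX (n : Bool → ℕ) (b : Bool) : PP n :=
  Monoid.CoprodI.of (i := b) (Multiplicative.ofAdd (1 : ZMod (n b)))

theorem gX_pow (n : Bool → ℕ) (b : Bool) : gX n b ^ n b = 1 := by
  rw [gX, ← map_pow, ← ofAdd_nsmul]; simp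

theorem PP_hom (n : Bool → ℕ) {H : Type*} [Group H] (x : Bool → H) (hx : ∀ b, x b ^ n b = 1) :
    ∃ f : PP n →* H, ∀ b, f (gX n b) = x b := by
  have := fun b => zmod_hom (n b) (x b) (hx b)
  choose f hf using this
  exact ⟨Monoid.CoprodI.lift f, fun b => by rw [gX, Monoid.CoprodI.lift_of, hf]⟩

theorem PP_tree (n : Bool → ℕ) : TreeLike (PP n) := treeLike_coprod _ (fun b => treeLike_zmod (n b))

theorem ker_zpow {G P : Type*} [Group G] [Group P] (φ : G →* P) (z : G) (hz : ∀ g, z * g = g * z)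
    (h : ∀ N : Subgroup G, ∀ _ : N.Normal, z ∈ N → ∃ ψ : P →* G ⧸ N, ψ.comp φ = QuotientGroup.mk' N)
    (g : G) (hg : φ g = 1) : ∃ j : ℤ, g = z ^ j := by
  have hn : (Subgroup.zpowers z).Normal := by
    constructor
    rintro _ ⟨j, rfl⟩ g
    have : Commute z g := hz g
    have := (this.zpow_left j).eq
    refine ⟨j, ?_⟩
    simp only
    rw [← this]; simp
  obtain ⟨ψ, hψ⟩ := h _ hn (Subgroup.mem_zpowers z)
  have h1 := DFunLike.congr_fun hψ g
  rw [MonoidHom.comp_apply, hg, map_one] at h1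
  have h2 := (QuotientGroup.eq_one_iff g).1 h1.symm
  obtain ⟨j, hj⟩ := h2
  exact ⟨j, hj.symm⟩

open Monoid.CoprodI in
theorem XY_inf (n : Bool → ℕ) (hn : ∀ b, 2 ≤ n b) (i : ℤ)
    (h : (gX n true * gX n false) ^ i = 1) : i = 0 := by
  have h1 : ∀ b, Multiplicative.ofAdd (1 : ZMod (n b)) ≠ 1 := by
    intro b hb
    have : Fact (1 < n b) := ⟨hn b⟩
    exact one_ne_zero (Multiplicative.ofAdd.injective hb : (1 : ZMod (n b)) = 0)
  have key : ∀ k : ℕ, ∃ w : Word (fun b => Multiplicative (ZMod (n b))),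
      w.prod = (gX n true * gX n false) ^ k ∧ w.fstIdx ≠ some false ∧ w.toList.length = 2 * k := by
    intro k
    induction k with
    | zero => exact ⟨Word.empty, by simp, by simp [Word.fstIdx, Word.empty], by simp [Word.empty]⟩
    | succ k ih =>
      obtain ⟨w, e1, e2, e3⟩ := ih
      refine ⟨Word.cons (i := true) _ (Word.cons (i := false) _ w e2 (h1 false)) (by simp) (h1 true), ?_, by simp, ?_⟩
      · rw [Word.prod_cons, Word.prod_cons, e1, pow_succ', mul_assoc]; rfl
      · simp [e3]; omega
  rw [← pow_natAbs_eq_one] at h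
  obtain ⟨w, e1, -, e3⟩ := key i.natAbs
  rw [h] at e1
  have : w = Word.empty := Word.equiv.symm.injective (e1.trans Word.prod_empty.symm)
  rw [this] at e3
  simp [Word.empty] at e3
  exact e3

theorem art_even (k : ℕ) (hk : 1 ≤ k) : asdim (Art (2 * k)) = 2 := by
  obtain ⟨S, hS⟩ := art_gen (2 * k)
  have rel := art_rel (2 * k)
  rw [braidProd_even, braidProd_even] at rel
  let n : Bool → ℕ := fun b => if b then k else 0
  have hX : gX n true ^ k = 1 := gX_pow n true
  obtain ⟨φ, φa, φb⟩ := art_hom (2 * k) (gX n false) ((gX n false)⁻¹ * gX n true) (by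
    rw [braidProd_even, braidProd_even, mul_inv_cancel_left, hX]
    have : (gX n false)⁻¹ * gX n true * gX n false =
      (gX n false)⁻¹ * gX n true * ((gX n false)⁻¹)⁻¹ := by simp
    rw [this, conj_pow, hX]; simp)
  obtain ⟨l, la, lb⟩ := art_hom (2 * k) (Multiplicative.ofAdd (1 : ℤ)) (Multiplicative.ofAdd 1) rfl
  set a := ga (2 * k)
  set b := gb (2 * k)
  have hza : (a * b) ^ k * a = a * (a * b) ^ k := by
    conv_rhs => rw [rel]
    exact (SemiconjBy.pow_right (show SemiconjBy a (b * a) (a * b) from by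
      simp [SemiconjBy, mul_assoc]) k).eq.symm
  have hzab : (a * b) ^ k * (a * b) = (a * b) * (a * b) ^ k := by rw [← pow_succ, ← pow_succ']
  have hzb : (a * b) ^ k * b = b * (a * b) ^ k := by
    have : b = a⁻¹ * (a * b) := by simp
    have c1 : Commute ((a * b) ^ k) a := hza
    have c2 : Commute ((a * b) ^ k) (a * b) := hzab
    have := c1.inv_right.mul_right c2
    simpa using this.eq
  have hz := art_central _ _ hza hzb
  refine asdim_eq_two (PP_tree n) S hS φ l ((a * b) ^ k) a ?_ ?_ ?_ ?_ hza
  · apply ker_zpow _ _ hz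
    intro N hN hzN
    obtain ⟨ψ, hψ⟩ := PP_hom n (fun c => if c then (QuotientGroup.mk' N (a * b)) else
      (QuotientGroup.mk' N a)) (by
        intro c
        cases c
        · simp [n]
        · simp only [n, if_true, ← map_pow]
          exact (QuotientGroup.eq_one_iff _).2 hzN)
    have p1 := hψ true
    have p2 := hψ false
    simp only [if_true] at p1
    simp only [Bool.false_eq_true, if_false] at p2
    refine ⟨ψ, art_ext _ _ _ ?_ ?_⟩
    · rw [MonoidHom.comp_apply, φa, p2]
    · rw [MonoidHom.comp_apply, φb, map_mul, map_inv, p1, p2, ← map_inv, ← map_mul]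
      simp [b]
  · rw [map_pow, map_mul, la, lb, ← ofAdd_add, ← ofAdd_nsmul]
    simp
    omega
  · rw [map_pow, map_mul, φa, φb, mul_inv_cancel_left, hX]
  · intro i hi
    rw [φa, gX, ← map_zpow, ← ofAdd_zsmul] at hi
    have h1 := Monoid.CoprodI.of_injective false (hi.trans (map_one _).symm)
    have h2 : i • (1 : ℤ) = 0 := Multiplicative.ofAdd.injective h1
    simpa using h2

theorem art_odd (k : ℕ) (hk : 1 ≤ k) : asdim (Art (2 * k + 1)) = 2 := by
  obtain ⟨S, hS⟩ := art_gen (2 * k + 1)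
  have rel := art_rel (2 * k + 1)
  rw [braidProd_odd, braidProd_odd] at rel
  let n : Bool → ℕ := fun b => if b then 2 * k + 1 else 2
  have hX : gX n true ^ (2 * k + 1) = 1 := gX_pow n true
  have hY : gX n false ^ 2 = 1 := gX_pow n false
  set X := gX n true
  set Y := gX n false
  have sw : ∀ {H : Type} [Group H] (x y : H), (y * x) ^ k * y = y * (x * y) ^ k := by
    intro H _ x y
    exact (SemiconjBy.pow_right (show SemiconjBy y (x * y) (y * x) from by
      simp [SemiconjBy, mul_assoc]) k).eq.symm
  have hab : ((X ^ k)⁻¹ * Y) * (Y⁻¹ * X ^ (k+1)) = X := by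
    rw [pow_succ]; group
  obtain ⟨φ, φa, φb⟩ := art_hom (2 * k + 1) ((X ^ k)⁻¹ * Y) (Y⁻¹ * X ^ (k+1)) (by
    rw [braidProd_odd, braidProd_odd, sw ((X ^ k)⁻¹ * Y), hab, mul_inv_cancel_left, mul_assoc,
      ← pow_add, show k + 1 + k = 2 * k + 1 by ring, hX, mul_one, eq_inv_iff_mul_eq_one, ← sq, hY])
  obtain ⟨l, la, lb⟩ := art_hom (2 * k + 1) (Multiplicative.ofAdd (1 : ℤ)) (Multiplicative.ofAdd 1) rfl
  set a := ga (2 * k + 1)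
  set b := gb (2 * k + 1)
  set x := a * b with hx
  rw [sw a b] at rel
  -- y = x^k a = b x^k
  have hy2 : (x ^ k * a) * (x ^ k * a) = x ^ (2 * k + 1) := by
    nth_rewrite 2 [rel]
    rw [mul_assoc, ← mul_assoc a, ← hx, ← pow_succ', ← pow_add]; congr 1; ring
  have c1 : Commute (x ^ (2 * k + 1)) (x ^ k * a) := by
    rw [← hy2]; exact (Commute.refl _).mul_left (Commute.refl _)
  have c2 : ∀ j : ℕ, Commute (x ^ (2 * k + 1)) (x ^ j) := fun j => Commute.pow_pow_self x _ _
  have hza : Commute (x ^ (2 * k + 1)) a := by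
    simpa using (c2 k).inv_right.mul_right c1
  have hzb : Commute (x ^ (2 * k + 1)) b := by
    simpa [hx] using hza.inv_right.mul_right (c2 1)
  have hz := art_central _ _ hza.eq hzb.eq
  have φx : φ x = X := by rw [hx, map_mul, φa, φb, hab]
  refine asdim_eq_two (PP_tree n) S hS φ l (x ^ (2 * k + 1)) (x * (x ^ k * a)) ?_ ?_ ?_ ?_ (hz _)
  · apply ker_zpow _ _ hz
    intro N hN hzN
    obtain ⟨ψ, hψ⟩ := PP_hom n (fun c => if c then (QuotientGroup.mk' N x) else
      (QuotientGroup.mk' N (x ^ k * a))) (by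
        intro c
        cases c
        · simp only [n, Bool.false_eq_true, if_false, ← map_pow]
          rw [sq, hy2]
          exact (QuotientGroup.eq_one_iff _).2 hzN
        · simp only [n, if_true, ← map_pow]
          exact (QuotientGroup.eq_one_iff _).2 hzN)
    have p1 : ψ X = _ := hψ true
    have p2 : ψ Y = _ := hψ false
    simp only [if_true] at p1
    simp only [Bool.false_eq_true, if_false] at p2
    refine ⟨ψ, art_ext _ _ _ ?_ ?_⟩
    · rw [MonoidHom.comp_apply, φa, map_mul, map_inv, map_pow, p1, p2, ← map_pow, ← map_inv,
        ← map_mul, inv_mul_cancel_left]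
    · rw [MonoidHom.comp_apply, φb, map_mul, map_inv, map_pow, p1, p2, ← map_pow, ← map_inv,
        ← map_mul]
      congr 1
      rw [mul_inv_rev, mul_assoc, pow_succ, inv_mul_cancel_left, hx, inv_mul_cancel_left]
  · rw [map_pow, hx, map_mul, la, lb, ← ofAdd_add, ← ofAdd_nsmul]
    simp
    omega
  · rw [map_pow, φx, hX]
  · intro i hi
    rw [φ.map_mul x, φ.map_mul (x ^ k), map_pow, φx, φa, mul_inv_cancel_left] at hi
    refine XY_inf n ?_ i hi
    intro c
    cases c <;> simp [n]; omega

end Aux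

/-- The Artin group on a single edge `[a,b]` with label `m ≥ 2` has asymptotic
dimension exactly `2`. -/
theorem asdim_dihedral_artin (m : ℕ) (hm : 2 ≤ m) :
    asdim (PresentedGroup
      ({braidWord m true false * (braidWord m false true)⁻¹} : Set (FreeGroup Bool))) = 2 := by
  obtain ⟨k, rfl | rfl⟩ := Nat.even_or_odd' m
  · exact art_even k (by omega)
  · exact art_odd k (by omega)
end
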